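/- arXiv:2002.01518 — 2 statements merged into one kernel-verified Lean document; each statement's English description precedes it below -/
import Mathlib

section
/- Let g_{n+k,n} denote the coefficient of x^n in the transformed Al-Salam–Chihara polynomial p̂_{n+k}(x). Then for all n, k ≥ 0, g_{n+k,n} = Σ_{μ ⊆ (k)×(2n+1)} u_n(μ), the sum over all partitions μ with at most k parts, each part of size at most 2n+1 (equivalently Young diagrams contained in a k × (2n+1) rectangle), where u_n is the weight defined in the context. -/
noncomputable section

open Finset

/-- The base ring `R = ℤ[α, β, ε₁, ε₂, q]`, with variables
`av = α`, `bv = β`, `e1v = ε₁`, `e2v = ε₂`, `qv = q`. -/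
abbrev R : Type := MvPolynomial (Fin 5) ℤ

def av : R := MvPolynomial.X 0
def bv : R := MvPolynomial.X 1
def e1v : R := MvPolynomial.X 2
def e2v : R := MvPolynomial.X 3
def qv : R := MvPolynomial.X 4

/-- `[n]_q = 1 + q + ⋯ + q^(n-1)`. -/
def qnum (n : ℕ) : R := ∑ i ∈ Finset.range n, qv ^ i

/-- The Gaussian (q-)binomial coefficient. -/
def qbinom : ℕ → ℕ → R
  | _, 0 => 1
  | 0, _ + 1 => 0
  | n + 1, k + 1 => qbinom n k + qv ^ (k + 1) * qbinom n (k + 1)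

/-- `X_i = α q^i + ε₁ [i]_q`. -/
def Xv (i : ℕ) : R := av * qv ^ i + e1v * qnum i

/-- `Y_i = β q^i + ε₂ [i]_q`. -/
def Yv (i : ℕ) : R := bv * qv ^ i + e2v * qnum i

/-- `b_n = (α+β) q^n + (ε₁+ε₂)[n]_q`. -/
def bcoef (n : ℕ) : R := (av + bv) * qv ^ n + (e1v + e2v) * qnum n

/-- `λ_n = ε₁ε₂[n]_q[n-1]_q + (αε₂+βε₁) q^(n-1) [n]_q + αβ(q^(2n-1) - q^(n-1))` (for `n ≥ 1`). -/
def lcoef (n : ℕ) : R :=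
  e1v * e2v * qnum n * qnum (n - 1) + (av * e2v + bv * e1v) * qv ^ (n - 1) * qnum n
    + av * bv * (qv ^ (2 * n - 1) - qv ^ (n - 1))

/-- The transformed Al-Salam-Chihara polynomials. -/
def phat : ℕ → Polynomial R
  | 0 => 1
  | 1 => Polynomial.X + Polynomial.C (bcoef 0)
  | n + 2 => (Polynomial.X + Polynomial.C (bcoef (n + 1))) * phat (n + 1)
      - Polynomial.C (lcoef (n + 1)) * phat n

/-- `g m i` is the coefficient of `x^i` in `p̂_m(x)`. -/
def g (m i : ℕ) : R := (phat m).coeff i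

/-- `Z_m = X_{⌊m/2⌋}` if `m` is even, `Y_{⌊m/2⌋}` if `m` is odd. -/
def Z (m : ℕ) : R := if m % 2 = 0 then Xv (m / 2) else Yv (m / 2)

/-- A partition with (at most) `l` parts, each `< c`, encoded as a function `Fin l → Fin c`,
extended to a function `ℕ → ℕ` by padding with zeros. -/
def extFn {l c : ℕ} (μ : Fin l → Fin c) : ℕ → ℕ :=
  fun j => if h : j < l then (μ ⟨j, h⟩ : ℕ) else 0

/-- The number of parts of `μ` (among the first `l` parts) equal to `v`. -/
def cnt (l : ℕ) (μ : ℕ → ℕ) (v : ℕ) : ℕ := ((Finset.range l).filter fun i => μ i = v).card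

/-- `s_m(μ)` for a partition `μ` with `l` parts (`μ 0 = μ₁` is the largest part):
`min(#{i : μᵢ = 0}, #{i : μᵢ = 2m+1})` if `μ₁ = 2m+1`, and `0` otherwise. -/
def spart (m l : ℕ) (μ : ℕ → ℕ) : ℕ :=
  if μ 0 = 2 * m + 1 then min (cnt l μ 0) (cnt l μ (2 * m + 1)) else 0

/-- The weight `u_m(μ)` for a partition `μ` with `l` parts: with `s = s_m(μ)`,
`u_m(μ) = (∏_{i=1}^{l-s} Z_{μ_{l+1-i}+2(i-1)}) · binom_q(m+l, s) · Y₀⋯Y_{s-1}`. -/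
def uweight (m l : ℕ) (μ : ℕ → ℕ) : R :=
  (∏ i ∈ Finset.range (l - spart m l μ), Z (μ (l - 1 - i) + 2 * i)) *
    qbinom (m + l) (spart m l μ) * ∏ j ∈ Finset.range (spart m l μ), Yv j


section FieldAlg

variable {F : Type*} [Field F]

/-- generic local identity, `N ≥ s+2`; `σ = [s]`, `t = [d-1]`, `d = N - s`. -/
lemma local_pos (α β e1 e2 q x σ t V0 Vsp Vup Vdn Wm : F)
    (X Y : F → F) (hX : ∀ y, X y = α + (α * (q - 1) + e1) * y)
    (hY : ∀ y, Y y = β + (β * (q - 1) + e2) * y)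
    (dd d1 qs ν ν1 μ μ1 qd qN κ : F)
    (hdd : dd = 1 + q * t) (hd1 : d1 = 1 + q * dd) (hqs : qs = 1 + (q - 1) * σ)
    (hν : ν = σ + qs * dd) (hν1 : ν1 = σ + qs * t)
    (hμ : μ = ν + (1 + (q - 1) * ν) * σ) (hμ1 : μ1 = ν1 + (1 + (q - 1) * ν1) * σ)
    (hqd : qd = 1 + (q - 1) * t) (hqN : qN = 1 + (q - 1) * ν)
    (hκ : κ = e1 * e2 * μ1 + (α * e2 + β * e1 + α * β * (q - 1)) * (1 + (q - 1) * μ1))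
    (ht : t ≠ 0) (hdd0 : dd ≠ 0) (hd10 : d1 ≠ 0)
    (star : t * Vsp = t * (x + (X ν + Y ν)) * V0 + qd * Vup - dd * (X ν1 * Y ν1) * Vdn)
    (star' : σ * (d1 * Vup - d1 * (x + (X σ + Y σ)) * V0 + Vsp + q * dd * Wm) = 0) :
    Vsp + qN * Vup - (x + (X μ + Y μ)) * V0 + κ * ν * Vdn
      = σ * (q ^ 2 * qd / d1 * (Wm - Vsp)) - ν * (qd / t * (X σ * Y σ * Vdn - Vup)) := by
  simp only [hX, hY] at *
  subst hκ hμ hμ1 hν hν1 hqd hqN hqs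
  subst hd1
  subst hdd
  linear_combination (norm := skip) ((σ + (1 + (q - 1) * σ) * (1 + q * t)) / ((1 + q * t) * t)) * star
    - (q * (1 + (q - 1) * t) / ((1 + q * t) * (1 + q * (1 + q * t)))) * star'
  field_simp
  ring

/-- generic local identity with the roles exchanged. -/
lemma local_neg (α β e1 e2 q x σ t V0 Vsp Vup Vdn Vm Om : F)
    (X Y : F → F) (hX : ∀ y, X y = α + (α * (q - 1) + e1) * y)
    (hY : ∀ y, Y y = β + (β * (q - 1) + e2) * y)
    (dd d1 qs ν ν1 μ qd κ : F)
    (hdd : dd = 1 + q * t) (hd1 : d1 = 1 + q * dd) (hqs : qs = 1 + (q - 1) * σ)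
    (hν : ν = σ + qs * dd) (hν1 : ν1 = σ + qs * t)
    (hμ : μ = ν + (1 + (q - 1) * ν) * σ)
    (hqd : qd = 1 + (q - 1) * t)
    (hκ : σ * (κ * d1) = σ * (X ν * Y ν - q ^ 2 * qd * Om))
    (ht : t ≠ 0) (hdd0 : dd ≠ 0) (hd10 : d1 ≠ 0)
    (star : t * Vsp = t * (x + (X ν + Y ν)) * V0 + qd * Vup - dd * (X ν1 * Y ν1) * Vdn)
    (star' : σ * (d1 * Vup - d1 * (x + (X σ + Y σ)) * V0 + Vsp + q * dd * (Om * Vm)) = 0) :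
    Vup + qs * Vsp - (x + (X μ + Y μ)) * V0 + κ * σ * Vm
      = ν * (-1 / t * (X ν1 * Y ν1 * Vdn - Vup)) - σ * (-1 / d1 * (X ν * Y ν * Vm - Vsp)) := by
  simp only [hX, hY] at *
  subst hμ hν hν1 hqd hqs
  subst hd1
  subst hdd
  linear_combination (norm := skip) ((σ + (1 + (q - 1) * σ) * (1 + q * t)) / ((1 + q * t) * t)) * star
    - (q * (1 + (q - 1) * t) / ((1 + q * t) * (1 + q * (1 + q * t)))) * star'
    + Vm / (1 + q * (1 + q * t)) * hκ
  field_simp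
  ring

lemma local_zero (α β e1 e2 q x ρ w : F)
    (X Y : F → F) (hX : ∀ y, X y = α + (α * (q - 1) + e1) * y)
    (hY : ∀ y, Y y = β + (β * (q - 1) + e2) * y)
    (σ μ μ1 qs κ V1 V0 : F)
    (hσ : σ = 1 + q * ρ) (hqs : qs = 1 + (q - 1) * σ)
    (hμ : μ = σ + (1 + (q - 1) * σ) * σ) (hμ1 : μ1 = ρ + (1 + (q - 1) * ρ) * σ)
    (hκ : κ = e1 * e2 * μ1 + (α * e2 + β * e1 + α * β * (q - 1)) * (1 + (q - 1) * μ1))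
    (hV1 : V1 = w * (X ρ * Y ρ) * (x + (X σ + Y σ)))
    (hV0 : V0 = w * (x + (X ρ + Y ρ))) :
    V1 + qs * V1 - (x + (X μ + Y μ)) * (2 * (w * (X ρ * Y ρ))) + κ * σ * V0
      = σ * (q * (X ρ * Y ρ * V0 - V1)) - σ * (-1 * (X σ * Y σ * V0 - V1)) := by
  simp only [hX, hY] at *
  subst hV1 hV0 hκ hμ hμ1 hqs
  subst hσ
  ring

lemma local_one (α β e1 e2 q x σ w V1 V2 Wm : F)
    (X Y : F → F) (hX : ∀ y, X y = α + (α * (q - 1) + e1) * y)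
    (hY : ∀ y, Y y = β + (β * (q - 1) + e2) * y)
    (σ1 μ μ1 qN κ : F)
    (hσ1 : σ1 = 1 + q * σ)
    (hμ : μ = σ1 + (1 + (q - 1) * σ1) * σ) (hμ1 : μ1 = σ + (1 + (q - 1) * σ) * σ)
    (hqN : qN = 1 + (q - 1) * σ1)
    (hκ : κ = e1 * e2 * μ1 + (α * e2 + β * e1 + α * β * (q - 1)) * (1 + (q - 1) * μ1))
    (hV1 : V1 = w * (x + (X σ + Y σ)))
    (hV2 : V2 = w * ((x + Y σ + X σ1) * (x + X σ) - X σ * Y σ + Y σ1 * (x + Y σ)))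
    (hWm : σ = 0 ∨ ∃ ρ, σ = 1 + q * ρ ∧
      Wm = w * ((x + Y ρ + X σ) * (x + X ρ) - X ρ * Y ρ + Y σ * (x + Y ρ)))
    (h2 : 1 + q ≠ 0) :
    V2 + qN * (2 * (w * (X σ * Y σ))) - (x + (X μ + Y μ)) * V1 + κ * σ1 * (2 * w)
      = σ * (q ^ 2 / (1 + q) * (Wm - V2))
        - σ1 * (w * (2 * (X σ * Y σ) - X σ * Y σ1 - X σ1 * Y σ)) := by
  simp only [hX, hY] at *
  subst hV1 hV2 hκ hμ hμ1 hqN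
  subst hσ1
  rcases hWm with h | ⟨ρ, h, h'⟩
  · subst h
    ring
  · subst h h'
    field_simp
    ring

lemma local_neg_one (α β e1 e2 q x σ w V1 V2 Vm : F)
    (X Y : F → F) (hX : ∀ y, X y = α + (α * (q - 1) + e1) * y)
    (hY : ∀ y, Y y = β + (β * (q - 1) + e2) * y)
    (σ1 μ μ1 qs κ : F)
    (hσ1 : σ1 = 1 + q * σ)
    (hμ : μ = σ1 + (1 + (q - 1) * σ1) * σ) (hμ1 : μ1 = σ + (1 + (q - 1) * σ) * σ)
    (hqs : qs = 1 + (q - 1) * σ)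
    (hκ : κ = e1 * e2 * μ1 + (α * e2 + β * e1 + α * β * (q - 1)) * (1 + (q - 1) * μ1))
    (hV1 : V1 = w * (x + (X σ + Y σ)))
    (hV2 : V2 = w * ((x + Y σ + X σ1) * (x + X σ) - X σ * Y σ + Y σ1 * (x + Y σ)))
    (hWm : σ = 0 ∨ ∃ ρ v, σ = 1 + q * ρ ∧ w = v * (X ρ * Y ρ) ∧
      Vm = v * ((x + Y ρ + X σ) * (x + X ρ) - X ρ * Y ρ + Y σ * (x + Y ρ)))
    (h2 : 1 + q ≠ 0) :
    2 * (w * (X σ * Y σ)) + qs * V2 - (x + (X μ + Y μ)) * V1 + κ * σ * Vm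
      = σ1 * (w * (2 * (X σ * Y σ) - X σ * Y σ1 - X σ1 * Y σ))
        - σ * (-1 / (1 + q) * (X σ1 * Y σ1 * Vm - V2)) := by
  simp only [hX, hY] at *
  subst hV1 hV2 hκ hμ hμ1 hqs
  subst hσ1
  rcases hWm with h | ⟨ρ, v, h, h', h''⟩
  · subst h
    ring
  · subst h'' h' h
    field_simp
    ring

end FieldAlg


section Polys

/-- sum over weakly monotone sequences of length `j` with `w` allowed values -/
def TT (u : ℕ) : ℕ → ℕ → R
  | _, 0 => 1
  | 0, _ + 1 => 0
  | w + 1, j + 1 => TT u w (j + 1) + Z (u + w + 2 * j) * TT u (w + 1) j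
termination_by w j => (w, j)

lemma TT_zero (u w : ℕ) : TT u w 0 = 1 := by
  cases w <;> simp [TT]

lemma TT_zero_succ (u j : ℕ) : TT u 0 (j + 1) = 0 := by
  simp [TT]

lemma TT_succ (u w j : ℕ) :
    TT u (w + 1) (j + 1) = TT u w (j + 1) + Z (u + w + 2 * j) * TT u (w + 1) j := by
  rw [TT]

lemma TT_left (u w j : ℕ) :
    TT u (w + 1) (j + 1) = TT (u + 1) w (j + 1) + Z u * TT (u + 2) (w + 1) j := by
  induction w generalizing j with
  | zero =>
    induction j with
    | zero => simp [TT_succ, TT_zero, TT_zero_succ]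
    | succ j ih =>
      rw [TT_succ, ih, TT_succ (u + 2)]
      simp only [TT_zero_succ]
      rw [show u + 0 + 2 * (j + 1) = u + 2 + 0 + 2 * j by ring]
      ring
  | succ w ihw =>
    induction j with
    | zero =>
      rw [TT_succ, ihw, TT_succ (u + 1)]
      simp only [TT_zero]
      rw [show u + (w + 1) + 2 * 0 = u + 1 + w + 2 * 0 by ring]
      ring
    | succ j ih =>
      rw [TT_succ, ihw, ih, TT_succ (u + 2) (w + 1), TT_succ (u + 1) w (j + 1)]
      rw [show u + (w + 1) + 2 * (j + 1) = u + 1 + w + 2 * (j + 1) by ring,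
        show u + 2 + (w + 1) + 2 * j = u + 1 + w + 2 * (j + 1) by ring]
      ring

/-- generating polynomials -/
def Gp (u d : ℕ) : Polynomial R :=
  ∑ n ∈ Finset.range (d + 1), Polynomial.monomial n (TT u (2 * n + 1) (d - n))

def Ep (u d : ℕ) : Polynomial R :=
  ∑ n ∈ Finset.range (d + 1), Polynomial.monomial n (TT u (2 * n) (d - n))

lemma Gp_coeff (u d n : ℕ) :
    (Gp u d).coeff n = if n ≤ d then TT u (2 * n + 1) (d - n) else 0 := by
  simp [Gp, Polynomial.coeff_monomial]

lemma Ep_coeff (u d n : ℕ) :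
    (Ep u d).coeff n = if n ≤ d then TT u (2 * n) (d - n) else 0 := by
  simp [Ep, Polynomial.coeff_monomial]

lemma Gp_zero (u : ℕ) : Gp u 0 = 1 := by
  simp [Gp, TT_zero]

lemma Gp_right (u d : ℕ) :
    Gp u (d + 1) = Ep u (d + 1) + Polynomial.C (Z (u + 2 * d)) * Gp u d := by
  ext1 n
  rw [Polynomial.coeff_add, Polynomial.coeff_C_mul, Gp_coeff, Gp_coeff, Ep_coeff]
  rcases Nat.lt_trichotomy n (d + 1) with h | h | h
  · obtain ⟨j, rfl⟩ : ∃ j, d = n + j := ⟨d - n, by omega⟩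
    rw [if_pos (by omega), if_pos (by omega), if_pos (by omega)]
    rw [show n + j + 1 - n = j + 1 by omega, show n + j - n = j by omega, TT_succ]
    rw [show u + 2 * n + 2 * j = u + 2 * (n + j) by ring]
  · subst h
    simp [TT_zero]
  · rw [if_neg (by omega), if_neg (by omega), if_neg (by omega)]
    simp

lemma Ep_right (u d : ℕ) :
    Ep u (d + 2) = Polynomial.X * Gp u (d + 1)
      + Polynomial.C (Z (u + 2 * d + 1)) * Ep u (d + 1) := by
  ext1 n
  cases n with
  | zero =>
    simp [Polynomial.coeff_add, Polynomial.coeff_C_mul, Ep_coeff, TT_zero_succ]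
  | succ n =>
    rw [Polynomial.coeff_add, Polynomial.coeff_C_mul, Polynomial.coeff_X_mul, Gp_coeff, Ep_coeff,
      Ep_coeff]
    rcases Nat.lt_trichotomy n (d + 1) with h | h | h
    · obtain ⟨j, rfl⟩ : ∃ j, d = n + j := ⟨d - n, by omega⟩
      rw [if_pos (by omega), if_pos (by omega), if_pos (by omega)]
      rw [show n + j + 2 - (n + 1) = j + 1 by omega, show n + j + 1 - n = j + 1 by omega,
        show n + j + 1 - (n + 1) = j by omega, show 2 * (n + 1) = 2 * n + 1 + 1 by ring, TT_succ]
      rw [show u + (2 * n + 1) + 2 * j = u + 2 * (n + j) + 1 by ring]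
    · subst h
      simp [TT_zero]
    · rw [if_neg (by omega), if_neg (by omega), if_neg (by omega)]
      simp

lemma Gp_left (u d : ℕ) :
    Gp u (d + 1) = Ep (u + 1) (d + 1) + Polynomial.C (Z u) * Gp (u + 2) d := by
  ext1 n
  rw [Polynomial.coeff_add, Polynomial.coeff_C_mul, Gp_coeff, Gp_coeff, Ep_coeff]
  rcases Nat.lt_trichotomy n (d + 1) with h | h | h
  · obtain ⟨j, rfl⟩ : ∃ j, d = n + j := ⟨d - n, by omega⟩
    rw [if_pos (by omega), if_pos (by omega), if_pos (by omega)]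
    rw [show n + j + 1 - n = j + 1 by omega, show n + j - n = j by omega, TT_left]
  · subst h
    simp [TT_zero]
  · rw [if_neg (by omega), if_neg (by omega), if_neg (by omega)]
    simp

lemma Z_even (i : ℕ) : Z (2 * i) = Xv i := by
  simp [Z]

lemma Z_odd (i : ℕ) : Z (2 * i + 1) = Yv i := by
  rw [Z, if_neg (by omega), show (2 * i + 1) / 2 = i by omega]

def PX (i : ℕ) : Polynomial R := Polynomial.C (Xv i)
def PY (i : ℕ) : Polynomial R := Polynomial.C (Yv i)
def PA (s d : ℕ) : Polynomial R := Gp (2 * s) d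
def PB (s d : ℕ) : Polynomial R := Gp (2 * s + 1) d

lemma PA_zero (s : ℕ) : PA s 0 = 1 := Gp_zero _
lemma PB_zero (s : ℕ) : PB s 0 = 1 := Gp_zero _

lemma Ep_one (u : ℕ) : Ep u 1 = Polynomial.X := by
  simp [Ep, Finset.sum_range_succ, TT_zero, TT_zero_succ, Polynomial.monomial_one_one_eq_X]

lemma PA_one (s : ℕ) : PA s 1 = Polynomial.X + PX s := by
  rw [PA, Gp_right, Ep_one, Gp_zero, PX, ← Z_even]; simp

lemma PB_one (s : ℕ) : PB s 1 = Polynomial.X + PY s := by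
  rw [PB, Gp_right, Ep_one, Gp_zero, PY, ← Z_odd]; simp

lemma PA_left (s d : ℕ) :
    PA s (d + 1) = PB s (d + 1) - PY (s + d) * PB s d + PX s * PA (s + 1) d := by
  have h1 := Gp_left (2 * s) d
  have h2 := Gp_right (2 * s + 1) d
  rw [show 2 * s + 1 + 2 * d = 2 * (s + d) + 1 by ring, Z_odd] at h2
  rw [Z_even] at h1
  simp only [PA, PB, PX, PY, show 2 * (s + 1) = 2 * s + 2 by ring]
  linear_combination h1 - h2

lemma PB_left (s d : ℕ) :
    PB s (d + 1) = PA (s + 1) (d + 1) - PX (s + d + 1) * PA (s + 1) d + PY s * PB (s + 1) d := by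
  have h1 := Gp_left (2 * s + 1) d
  have h2 := Gp_right (2 * s + 2) d
  rw [show 2 * s + 2 + 2 * d = 2 * (s + d + 1) by ring, Z_even] at h2
  rw [Z_odd] at h1
  simp only [PA, PB, PX, PY, show 2 * (s + 1) = 2 * s + 2 by ring]
  rw [show 2 * s + 1 + 2 = 2 * s + 2 + 1 by ring] at h1
  linear_combination h1 - h2

lemma PA_rec (s d : ℕ) :
    PA s (d + 2) = (Polynomial.X + PY (s + d) + PX (s + d + 1)) * PA s (d + 1)
      - PX (s + d) * PY (s + d) * PA s d := by
  have h1 := Gp_right (2 * s) (d + 1)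
  have h2 := Gp_right (2 * s) d
  have h3 := Ep_right (2 * s) d
  rw [show 2 * s + 2 * d = 2 * (s + d) by ring] at h2 h3
  rw [show 2 * s + 2 * (d + 1) = 2 * (s + d + 1) by ring] at h1
  rw [Z_even] at h1 h2
  rw [Z_odd] at h3
  simp only [PA, PX, PY]
  linear_combination h1 + h3 - Polynomial.C (Yv (s + d)) * h2

lemma PB_rec (s d : ℕ) :
    PB s (d + 2) = (Polynomial.X + PX (s + d + 1) + PY (s + d + 1)) * PB s (d + 1)
      - PX (s + d + 1) * PY (s + d) * PB s d := by
  have h1 := Gp_right (2 * s + 1) (d + 1)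
  have h2 := Gp_right (2 * s + 1) d
  have h3 := Ep_right (2 * s + 1) d
  rw [show 2 * s + 1 + 2 * d = 2 * (s + d) + 1 by ring] at h2
  rw [show 2 * s + 1 + 2 * d + 1 = 2 * (s + d + 1) by ring] at h3
  rw [show 2 * s + 1 + 2 * (d + 1) = 2 * (s + d + 1) + 1 by ring] at h1
  rw [Z_odd] at h1 h2
  rw [Z_even] at h3
  simp only [PB, PX, PY]
  linear_combination h1 + h3 - Polynomial.C (Xv (s + d + 1)) * h2

/-- `D s d`, symmetric normalisation: `D s 0 = 2`. -/
def PD (s : ℕ) : ℕ → Polynomial R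
  | 0 => 2
  | d + 1 => PA s (d + 1) + PY (s + d) * PB s d

lemma PD_one (s : ℕ) : PD s 1 = Polynomial.X + (PX s + PY s) := by
  simp only [PD, PB_zero, zero_add, PA_one]
  simp only [add_zero]; ring

lemma PD_two (s : ℕ) : PD s 2 = (Polynomial.X + PY s + PX (s + 1)) * (Polynomial.X + PX s)
    - PX s * PY s + PY (s + 1) * (Polynomial.X + PY s) := by
  have := PA_rec s 0
  simp only [PD]
  simp only [zero_add, add_zero, PA_one, PB_one, PA_zero] at *
  rw [this]
  ring

def Pq : Polynomial R := Polynomial.C qv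
def Pn (n : ℕ) : Polynomial R := Polynomial.C (qnum n)
def Pal : Polynomial R := Polynomial.C av
def Pbe : Polynomial R := Polynomial.C bv
def Pe1 : Polynomial R := Polynomial.C e1v
def Pe2 : Polynomial R := Polynomial.C e2v

lemma qpow (n : ℕ) : qv ^ n = 1 + (qv - 1) * qnum n := by
  have := mul_neg_geom_sum qv n
  rw [qnum]
  linear_combination this

lemma qnum_zero : qnum 0 = 0 := by simp [qnum]
lemma qnum_one : qnum 1 = 1 := by simp [qnum]

lemma qnum_succ (n : ℕ) : qnum (n + 1) = 1 + qv * qnum n := by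
  have := qpow n
  have h : qnum (n + 1) = qnum n + qv ^ n := by simp [qnum, Finset.sum_range_succ]
  rw [h, this]; ring

lemma qnum_add (m n : ℕ) : qnum (m + n) = qnum m + (1 + (qv - 1) * qnum m) * qnum n := by
  induction n with
  | zero => simp [qnum_zero]
  | succ n ih => rw [← add_assoc, qnum_succ, qnum_succ, ih]; ring

lemma Pn_succ (n : ℕ) : Pn (n + 1) = 1 + Pq * Pn n := by
  simp [Pn, Pq, qnum_succ]

lemma Pn_add (m n : ℕ) : Pn (m + n) = Pn m + (1 + (Pq - 1) * Pn m) * Pn n := by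
  simp [Pn, Pq, qnum_add]

lemma PX_eq (n : ℕ) : PX n = Pal + (Pal * (Pq - 1) + Pe1) * Pn n := by
  simp only [PX, Xv, Pal, Pq, Pe1, Pn, qpow, ← Polynomial.C_mul, ← Polynomial.C_add,
    ← Polynomial.C_sub, ← Polynomial.C_1]
  congr 1; ring

lemma PY_eq (n : ℕ) : PY n = Pbe + (Pbe * (Pq - 1) + Pe2) * Pn n := by
  simp only [PY, Yv, Pbe, Pq, Pe2, Pn, qpow, ← Polynomial.C_mul, ← Polynomial.C_add,
    ← Polynomial.C_sub, ← Polynomial.C_1]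
  congr 1; ring

lemma PD_star (s e : ℕ) :
    Pn (e + 1) * PD s (e + 3) = Pn (e + 1) * (Polynomial.X + (PX (s + e + 2) + PY (s + e + 2)))
        * PD s (e + 2)
      + (1 + (Pq - 1) * Pn (e + 1)) * (PX s * PY s * PD (s + 1) (e + 1))
      - Pn (e + 2) * (PX (s + e + 1) * PY (s + e + 1)) * PD s (e + 1) := by
  simp only [PD]
  have a1 := PA_left s (e + 2)
  have a2 := PA_left s (e + 1)
  have a3 := PA_left s e
  have a4 := PB_left s e
  have a5 := PB_rec s (e + 1)
  have a6 := PA_rec (s + 1) e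
  simp only [← add_assoc, show s + 1 + e = s + e + 1 by ring] at *
  rw [a1, a2, a3, a5, a6]
  have c1 : Pn (e + 1 + 1) = 1 + Pq * Pn (e + 1) := Pn_succ _
  have c3 := Pn_add s (e + 1)
  have c4 : Pn (s + e + 1 + 1) = 1 + Pq * Pn (s + e + 1) := Pn_succ _
  rw [← add_assoc] at c3
  have X1 := PX_eq (s + e + 1)
  have X2 := PX_eq (s + e + 2)
  have Y1 := PY_eq (s + e + 1)
  have Y2 := PY_eq (s + e + 2)
  have X0 := PX_eq s
  have Y0 := PY_eq s
  simp only [show s + e + 2 = s + e + 1 + 1 by ring, show e + 2 = e + 1 + 1 by ring] at *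
  rw [c4] at X2 Y2
  rw [c3] at X1 X2 Y1 Y2
  rw [c1]
  have a4' : PX s * (PY s * PB (s + 1) e) = PX s * (PB s (e + 1) - PA (s + 1) (e + 1) + PX (s + e + 1) * PA (s + 1) e) := by
    rw [a4]; ring
  have E : (1 + (Pq - 1) * Pn (e + 1)) * (PX s * PY s * (PA (s + 1) (e + 1) + PY (s + e + 1) * PB (s + 1) e))
     = (1 + (Pq - 1) * Pn (e + 1)) * (PX s * PY s * PA (s + 1) (e + 1) + PY (s + e + 1) * (PX s * (PB s (e + 1) - PA (s + 1) (e + 1) + PX (s + e + 1) * PA (s + 1) e))) := by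
    rw [← a4']; ring
  rw [E]
  clear E a4' a1 a2 a3 a4 a5 a6
  generalize PA (s + 1) (e + 1) = A1
  generalize PA (s + 1) e = A0
  generalize PB s (e + 1) = B1
  generalize PB s (e + 1 + 1) = B2
  rw [X1, X2, Y1, Y2, X0, Y0]
  ring

lemma PD_star' (s e : ℕ) :
    Pn (e + 3) * (PX (s + 1) * PY (s + 1) * PD (s + 2) (e + 1)) =
      Pn (e + 3) * (Polynomial.X + (PX (s + 1) + PY (s + 1))) * PD (s + 1) (e + 2)
      - PD (s + 1) (e + 3) - Pq * Pn (e + 2) * PD s (e + 3) := by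
  simp only [PD]
  have a0 := PA_left s (e + 2)
  have a1 := PB_left s (e + 2)
  have b1 := PA_left (s + 1) (e + 1)
  have b2 := PA_left (s + 1) e
  have b3 := PB_left (s + 1) e
  have r1 := PB_rec (s + 1) e
  have r2 := PA_rec (s + 1) (e + 1)
  simp only [show s + 1 + (e + 1) = s + e + 2 by ring, show s + 1 + (e + 2) = s + e + 3 by ring,
    show s + 1 + e = s + e + 1 by ring, show s + 2 + e = s + e + 2 by ring,
    show s + (e + 2) = s + e + 2 by ring, show s + e + 2 + 1 = s + e + 3 by ring,
    show s + e + 1 + 1 = s + e + 2 by ring, show e + 1 + 1 = e + 2 by ring,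
    show e + 1 + 2 = e + 3 by ring, show e + 2 + 1 = e + 3 by ring,
    show s + 1 + 1 = s + 2 by ring] at *
  have h : PX (s + 1) * PY (s + 1) * (PA (s + 2) (e + 1) + PY (s + e + 2) * PB (s + 2) e)
      = PY (s + 1) * (PA (s + 1) (e + 2) - PB (s + 1) (e + 2) + PY (s + e + 2) * PB (s + 1) (e + 1))
        + PY (s + e + 2) * (PX (s + 1) * PB (s + 1) (e + 1)
          - (PA (s + 1) (e + 2) - PB (s + 1) (e + 2) + PY (s + e + 2) * PB (s + 1) (e + 1))
          + PX (s + e + 2) * (PA (s + 1) (e + 1) - PB (s + 1) (e + 1)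
            + PY (s + e + 1) * PB (s + 1) e)) := by
    linear_combination (-PY (s + 1) + PY (s + e + 2)) * b1
      - PX (s + e + 2) * PY (s + e + 2) * b2 - PX (s + 1) * PY (s + e + 2) * b3
  rw [h, a0, a1, r2, r1]
  clear h a0 a1 r2 r1 b1 b2 b3
  generalize PA (s + 1) (e + 2) = A2
  generalize PA (s + 1) (e + 1) = A1
  generalize PB (s + 1) (e + 1) = B1
  generalize PB (s + 1) e = B0
  simp only [PX_eq, PY_eq]
  have c1 : Pn (e + 2) = 1 + Pq * Pn (e + 1) := Pn_succ _
  have c2 : Pn (e + 3) = 1 + Pq * Pn (e + 2) := Pn_succ _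
  have c0 : Pn (e + 1) = 1 + Pq * Pn e := Pn_succ _
  have d0 := Pn_add s e
  have d1 : Pn (s + e + 1) = 1 + Pq * Pn (s + e) := Pn_succ _
  have d2 : Pn (s + e + 2) = 1 + Pq * Pn (s + e + 1) := Pn_succ _
  have d3 : Pn (s + e + 3) = 1 + Pq * Pn (s + e + 2) := Pn_succ _
  have d4 : Pn (s + 1) = 1 + Pq * Pn s := Pn_succ _
  rw [d3, d2, d1, d0, d4, c2, c1, c0]
  ring

end Polys


section Sums

def Pw (s : ℕ) : Polynomial R := ∏ i ∈ Finset.range s, PX i * PY i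

lemma Pw_succ (s : ℕ) : Pw (s + 1) = Pw s * (PX s * PY s) := by
  rw [Pw, Finset.prod_range_succ, ← Pw]

/-- symmetric extension -/
def PV (s N : ℕ) : Polynomial R :=
  if s ≤ N then Pw s * PD s (N - s) else Pw N * PD N (s - N)

lemma PV_le (s d N : ℕ) (h : N = s + d) : PV s N = Pw s * PD s d := by
  subst h
  rw [PV, if_pos (by omega), Nat.add_sub_cancel_left]

lemma PV_ge (s d N : ℕ) (h : N = s + d) : PV N s = Pw s * PD s d := by
  subst h
  rcases Nat.eq_zero_or_pos d with rfl | hd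
  · rw [PV, if_pos (by omega)]; simp
  · rw [PV, if_neg (by omega), Nat.add_sub_cancel_left]

def Pk (m : ℕ) : Polynomial R :=
  Pe1 * Pe2 * Pn m + (Pal * Pe2 + Pbe * Pe1 + Pal * Pbe * (Pq - 1)) * (1 + (Pq - 1) * Pn m)

variable {F : Type*} [Field F] (ι : Polynomial R →+* F)

def RR (s N : ℕ) : F :=
  if s ≤ N then
    ι (Pq ^ (N + 1 - s)) / ι (Pn (N + 1 - s)) *
      (ι (PX (s - 1) * PY (s - 1) * PV (s - 1) N) - ι (PV s (N + 1)))
  else if s = N + 1 then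
    ι (Pw N * (2 * (PX N * PY N) - PX N * PY (N + 1) - PX (N + 1) * PY N))
  else
    -1 / ι (Pn (s - N - 1)) *
      (ι (PX (s - 1) * PY (s - 1) * PV (s - 1) N) - ι (PV s (N + 1)))

lemma Pq_pow (n : ℕ) : Pq ^ n = 1 + (Pq - 1) * Pn n := by
  simp only [Pq, Pn, ← Polynomial.C_pow, qpow]; simp

lemma Pn_zero : Pn 0 = 0 := by simp [Pn, qnum_zero]
lemma Pn_one : Pn 1 = 1 := by simp [Pn, qnum_one]

def LocalId (s N : ℕ) : Prop :=
  ι (PV s (N + 1)) + ι (Pq ^ N) * ι (PV (s + 1) N)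
      - (ι Polynomial.X + (ι (PX (s + N)) + ι (PY (s + N)))) * ι (PV s N)
      + ι (Pk (s + N - 1)) * ι (Pn N) * ι (PV s (N - 1))
    = ι (Pn s) * RR ι s N - ι (Pn N) * RR ι (s + 1) (N - 1)

lemma local_case_pos (hn : ∀ n, ι (Pn (n + 1)) ≠ 0) (s e : ℕ) : LocalId ι s (s + e + 2) := by
  have key := local_pos (ι Pal) (ι Pbe) (ι Pe1) (ι Pe2) (ι Pq) (ι Polynomial.X)
    (ι (Pn s)) (ι (Pn (e + 1))) (ι (PV s (s + e + 2))) (ι (PV s (s + e + 3)))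
    (ι (PV (s + 1) (s + e + 2))) (ι (PV s (s + e + 1)))
    (ι (PX (s - 1) * PY (s - 1) * PV (s - 1) (s + e + 2)))
    _ _ (fun y => rfl) (fun y => rfl)
    (ι (Pn (e + 2))) (ι (Pn (e + 3))) (ι (Pq ^ s)) (ι (Pn (s + e + 2))) (ι (Pn (s + e + 1)))
    (ι (Pn (s + (s + e + 2)))) (ι (Pn (s + e + 1 + s))) (ι (Pq ^ (e + 1))) (ι (Pq ^ (s + e + 2)))
    (ι (Pk (s + e + 1 + s)))
    (by rw [Pn_succ (e + 1)]; simp) (by rw [Pn_succ (e + 2)]; simp) (by rw [Pq_pow]; simp)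
    (by rw [Pq_pow, show s + e + 2 = s + (e + 2) by ring, Pn_add]; simp)
    (by rw [Pq_pow, show s + e + 1 = s + (e + 1) by ring, Pn_add]; simp)
    (by rw [show s + (s + e + 2) = (s + e + 2) + s by ring, Pn_add (s + e + 2)]; simp)
    (by rw [Pn_add (s + e + 1) s]; simp)
    (by rw [Pq_pow]; simp) (by rw [Pq_pow]; simp) (by rw [Pk]; simp)
    (hn _) (hn _) (hn _)
    (by
      have h := congrArg (fun y => ι (Pw s * y)) (PD_star s e)
      rw [PV_le s (e + 2) (s + e + 2) (by ring), PV_le s (e + 3) (s + e + 3) (by ring),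
        PV_le s (e + 1) (s + e + 1) (by ring), PV_le (s + 1) (e + 1) (s + e + 2) (by ring), Pw_succ, Pq_pow]
      simp only [PX_eq, PY_eq, map_mul, map_add, map_sub, map_one] at h ⊢
      linear_combination h)
    (by
      cases s with
      | zero => simp [Pn_zero]
      | succ s =>
        have h := congrArg (fun y => ι (Pn (s + 1) * Pw (s + 1) * y)) (PD_star' s e)
        rw [PV_le (s + 1) (e + 2) (s + 1 + e + 2) (by ring),
          PV_le (s + 1) (e + 3) (s + 1 + e + 3) (by ring),
          PV_le (s + 1 + 1) (e + 1) (s + 1 + e + 2) (by ring), Pw_succ (s + 1), Nat.add_sub_cancel,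
          PV_le s (e + 3) (s + 1 + e + 2) (by ring), show PX s * PY s * (Pw s * PD s (e + 3))
            = Pw (s + 1) * PD s (e + 3) by rw [Pw_succ]; ring]
        simp only [PX_eq, PY_eq, map_mul, map_add, map_sub, map_one] at h ⊢
        linear_combination h)
  rw [LocalId, RR, RR, if_pos (by omega), if_pos (by omega)]
  rw [show s + e + 2 + 1 - s = e + 3 by omega, show s + e + 2 - 1 = s + e + 1 by omega,
    show s + e + 1 + 1 - (s + 1) = e + 1 by omega, show s + 1 - 1 = s by omega,
    show s + (s + e + 2) - 1 = s + e + 1 + s by omega, show s + e + 1 + 1 = s + e + 2 by ring,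
    show s + e + 2 + 1 = s + e + 3 by ring]
  simp only [PX_eq, PY_eq, map_mul, map_add, map_sub, map_one, map_pow] at key ⊢
  rw [show ι Pq ^ (e + 3) = ι Pq ^ 2 * ι Pq ^ (e + 1) by ring]
  exact key

lemma local_case_neg (hn : ∀ n, ι (Pn (n + 1)) ≠ 0) (s e : ℕ) : LocalId ι (s + e + 2) s := by
  have key := local_neg (ι Pal) (ι Pbe) (ι Pe1) (ι Pe2) (ι Pq) (ι Polynomial.X)
    (ι (Pn s)) (ι (Pn (e + 1))) (ι (PV s (s + e + 2))) (ι (PV s (s + e + 3)))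
    (ι (PV (s + 1) (s + e + 2))) (ι (PV s (s + e + 1)))
    (ι (PV (s - 1) (s + e + 2))) (ι (PX (s - 1) * PY (s - 1)))
    _ _ (fun y => rfl) (fun y => rfl)
    (ι (Pn (e + 2))) (ι (Pn (e + 3))) (ι (Pq ^ s)) (ι (Pn (s + e + 2))) (ι (Pn (s + e + 1)))
    (ι (Pn (s + e + 2 + s))) (ι (Pq ^ (e + 1)))
    (ι (Pk (s + e + 2 + s - 1)))
    (by rw [Pn_succ (e + 1)]; simp) (by rw [Pn_succ (e + 2)]; simp) (by rw [Pq_pow]; simp)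
    (by rw [Pq_pow, show s + e + 2 = s + (e + 2) by ring, Pn_add]; simp)
    (by rw [Pq_pow, show s + e + 1 = s + (e + 1) by ring, Pn_add]; simp)
    (by rw [Pn_add (s + e + 2)]; simp)
    (by rw [Pq_pow]; simp)
    (by
      cases s with
      | zero => simp [Pn_zero]
      | succ s =>
        rw [show s + 1 + e + 2 + (s + 1) - 1 = s + (e + 3) + s by omega,
          show s + 1 + e + 2 = s + (e + 3) by ring, Nat.add_sub_cancel, Pq_pow, Pk,
          Pn_add (s + (e + 3)) s, Pn_add s (e + 3), Pn_succ (e + 2), Pn_succ (e + 1)]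
        simp only [PX_eq, PY_eq, map_mul, map_add, map_sub, map_one]
        ring)
    (hn _) (hn _) (hn _)
    (by
      have h := congrArg (fun y => ι (Pw s * y)) (PD_star s e)
      rw [PV_le s (e + 2) (s + e + 2) (by ring), PV_le s (e + 3) (s + e + 3) (by ring),
        PV_le s (e + 1) (s + e + 1) (by ring), PV_le (s + 1) (e + 1) (s + e + 2) (by ring), Pw_succ, Pq_pow]
      simp only [PX_eq, PY_eq, map_mul, map_add, map_sub, map_one] at h ⊢
      linear_combination h)
    (by
      cases s with
      | zero => simp [Pn_zero]
      | succ s =>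
        have h := congrArg (fun y => ι (Pn (s + 1) * Pw (s + 1) * y)) (PD_star' s e)
        rw [← map_mul ι (PX (s + 1 - 1) * PY (s + 1 - 1)),
          PV_le (s + 1) (e + 2) (s + 1 + e + 2) (by ring),
          PV_le (s + 1) (e + 3) (s + 1 + e + 3) (by ring),
          PV_le (s + 1 + 1) (e + 1) (s + 1 + e + 2) (by ring), Pw_succ (s + 1), Nat.add_sub_cancel,
          PV_le s (e + 3) (s + 1 + e + 2) (by ring), show PX s * PY s * (Pw s * PD s (e + 3))
            = Pw (s + 1) * PD s (e + 3) by rw [Pw_succ]; ring]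
        simp only [PX_eq, PY_eq, map_mul, map_add, map_sub, map_one] at h ⊢
        linear_combination h)
  have sw : ∀ a b, PV a b = PV b a := by
    intro a b
    rcases le_total a b with h | h
    · obtain ⟨d, rfl⟩ := Nat.exists_eq_add_of_le h
      rw [PV_le a d _ rfl, PV_ge a d _ rfl]
    · obtain ⟨d, rfl⟩ := Nat.exists_eq_add_of_le h
      rw [PV_le b d _ rfl, PV_ge b d _ rfl]
  rw [LocalId, RR, if_neg (by omega), if_neg (by omega)]
  rw [show s + e + 2 - s - 1 = e + 1 by omega, show s + e + 2 - 1 = s + e + 1 by omega]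
  rw [sw (s + e + 2) (s + 1), sw (s + e + 2 + 1) s, sw (s + e + 2) s, sw (s + e + 2) (s - 1),
    sw (s + e + 1) s, show s + e + 2 + 1 = s + e + 3 by ring]
  have e2 : ι (Pn s) * RR ι (s + e + 3) (s - 1) = ι (Pn s) * (-1 / ι (Pn (e + 3)) *
     (ι (PX (s + e + 2) * PY (s + e + 2) * PV (s - 1) (s + e + 2)) - ι (PV s (s + e + 3)))) := by
    cases s with
    | zero => simp [Pn_zero]
    | succ s =>
      rw [RR, if_neg (by omega), if_neg (by omega),
        show s + 1 + e + 3 - (s + 1 - 1) - 1 = e + 3 by omega,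
        show s + 1 + e + 3 - 1 = s + 1 + e + 2 by omega, sw (s + 1 + e + 2), sw (s + 1 + e + 3),
        show s + 1 - 1 + 1 = s + 1 by omega]
  rw [e2]
  simp only [PX_eq, PY_eq, map_mul, map_add, map_sub, map_one, map_pow] at key ⊢
  exact key

end Sums


section Sums2

variable {F : Type*} [Field F] (ι : Polynomial R →+* F)

lemma PV_diag (s : ℕ) : PV s s = 2 * Pw s := by
  rw [PV_le s 0 s rfl, PD]; ring

lemma PV_swap (a b : ℕ) : PV a b = PV b a := by
  rcases le_total a b with h | h
  · obtain ⟨d, rfl⟩ := Nat.exists_eq_add_of_le h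
    rw [PV_le a d _ rfl, PV_ge a d _ rfl]
  · obtain ⟨d, rfl⟩ := Nat.exists_eq_add_of_le h
    rw [PV_le b d _ rfl, PV_ge b d _ rfl]

lemma local_case_zero (r : ℕ) : LocalId ι (r + 1) (r + 1) := by
  have key := local_zero (ι Pal) (ι Pbe) (ι Pe1) (ι Pe2) (ι Pq) (ι Polynomial.X)
    (ι (Pn r)) (ι (Pw r)) _ _ (fun y => rfl) (fun y => rfl)
    (ι (Pn (r + 1))) (ι (Pn (r + 1 + (r + 1)))) (ι (Pn (r + (r + 1)))) (ι (Pq ^ (r + 1)))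
    (ι (Pk (r + (r + 1)))) (ι (PV (r + 1) (r + 2))) (ι (PV r (r + 1)))
    (by rw [Pn_succ r]; simp) (by rw [Pq_pow]; simp)
    (by rw [Pn_add (r + 1)]; simp)
    (by rw [Pn_add r]; simp)
    (by rw [Pk]; simp)
    (by
      rw [PV_le (r + 1) 1 (r + 2) (by ring), PD_one, Pw_succ]
      simp only [PX_eq, PY_eq, map_mul, map_add, map_sub, map_one])
    (by
      rw [PV_le r 1 (r + 1) (by ring), PD_one]
      simp only [PX_eq, PY_eq, map_mul, map_add, map_sub, map_one])
  rw [LocalId, RR, RR, if_pos (by omega), if_neg (by omega), if_neg (by omega)]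
  rw [show r + 1 + 1 - (r + 1) = 1 by omega, show r + 1 - 1 = r by omega,
    show r + 1 + 1 - r - 1 = 1 by omega, show r + 1 + 1 - 1 = r + 1 by omega,
    show r + 1 + (r + 1) - 1 = r + (r + 1) by omega,
    show r + 1 + 1 = r + 2 by ring, PV_swap (r + 2) (r + 1), PV_swap (r + 1) r,
    PV_diag, Pw_succ, Pn_one]
  simp only [PX_eq, PY_eq, map_mul, map_add, map_sub, map_one, map_pow, pow_one, div_one,
    map_ofNat] at key ⊢
  exact key

lemma local_case_one (hn : ∀ n, ι (Pn (n + 1)) ≠ 0) (s : ℕ) : LocalId ι s (s + 1) := by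
  have h2 : ι (Pn 2) = 1 + ι Pq := by
    rw [Pn_succ 1, Pn_one]; simp
  have key := local_one (ι Pal) (ι Pbe) (ι Pe1) (ι Pe2) (ι Pq) (ι Polynomial.X)
    (ι (Pn s)) (ι (Pw s)) (ι (PV s (s + 1))) (ι (PV s (s + 2)))
    (ι (PX (s - 1) * PY (s - 1) * PV (s - 1) (s + 1)))
    _ _ (fun y => rfl) (fun y => rfl)
    (ι (Pn (s + 1))) (ι (Pn (s + 1 + s))) (ι (Pn (s + s))) (ι (Pq ^ (s + 1)))
    (ι (Pk (s + s)))
    (by rw [Pn_succ s]; simp) (by rw [Pn_add (s + 1)]; simp)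
    (by rw [Pn_add s]; simp)
    (by rw [Pq_pow]; simp)
    (by rw [Pk]; simp)
    (by
      rw [PV_le s 1 (s + 1) (by ring), PD_one]
      simp only [PX_eq, PY_eq, map_mul, map_add, map_sub, map_one])
    (by
      rw [PV_le s 2 (s + 2) (by ring), PD_two]
      simp only [PX_eq, PY_eq, map_mul, map_add, map_sub, map_one])
    (by
      cases s with
      | zero => left; simp [Pn_zero]
      | succ r =>
        right
        refine ⟨ι (Pn r), by rw [Pn_succ r]; simp, ?_⟩
        rw [PV_le (r + 1 - 1) 2 (r + 1 + 1) (by omega), Nat.add_sub_cancel, PD_two, Pw_succ]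
        simp only [PX_eq, PY_eq, map_mul, map_add, map_sub, map_one]
        ring)
    (by rw [← h2]; exact hn 1)
  rw [LocalId, RR, RR, if_pos (by omega), if_neg (by omega), if_pos (by omega)]
  rw [show s + 1 + 1 - s = 2 by omega, show s + 1 - 1 = s by omega,
    show s + (s + 1) - 1 = s + s by omega, h2,
    show s + 1 + 1 = s + 2 by ring,
    PV_diag, PV_diag, Pw_succ, show s + (s + 1) = s + 1 + s by ring]
  simp only [PX_eq, PY_eq, map_mul, map_add, map_sub, map_one, map_pow, pow_one, div_one,
    map_ofNat] at key ⊢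
  exact key

lemma local_case_neg_one (hn : ∀ n, ι (Pn (n + 1)) ≠ 0) (s : ℕ) : LocalId ι (s + 1) s := by
  have h2 : ι (Pn 2) = 1 + ι Pq := by
    rw [Pn_succ 1, Pn_one]; simp
  have key := local_neg_one (ι Pal) (ι Pbe) (ι Pe1) (ι Pe2) (ι Pq) (ι Polynomial.X)
    (ι (Pn s)) (ι (Pw s)) (ι (PV s (s + 1))) (ι (PV s (s + 2)))
    (ι (PV (s - 1) (s + 1)))
    _ _ (fun y => rfl) (fun y => rfl)
    (ι (Pn (s + 1))) (ι (Pn (s + 1 + s))) (ι (Pn (s + s))) (ι (Pq ^ s))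
    (ι (Pk (s + s)))
    (by rw [Pn_succ s]; simp) (by rw [Pn_add (s + 1)]; simp)
    (by rw [Pn_add s]; simp)
    (by rw [Pq_pow]; simp)
    (by rw [Pk]; simp)
    (by
      rw [PV_le s 1 (s + 1) (by ring), PD_one]
      simp only [PX_eq, PY_eq, map_mul, map_add, map_sub, map_one])
    (by
      rw [PV_le s 2 (s + 2) (by ring), PD_two]
      simp only [PX_eq, PY_eq, map_mul, map_add, map_sub, map_one])
    (by
      cases s with
      | zero => left; simp [Pn_zero]
      | succ r =>
        right
        refine ⟨ι (Pn r), ι (Pw r), by rw [Pn_succ r]; simp, ?_, ?_⟩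
        · rw [Pw_succ]
          simp only [PX_eq, PY_eq, map_mul, map_add, map_sub, map_one]
        rw [PV_le (r + 1 - 1) 2 (r + 1 + 1) (by omega), Nat.add_sub_cancel, PD_two]
        simp only [PX_eq, PY_eq, map_mul, map_add, map_sub, map_one])
    (by rw [← h2]; exact hn 1)
  have e2 : ι (Pn s) * RR ι (s + 2) (s - 1) = ι (Pn s) * (-1 / (1 + ι Pq) *
     (ι (PX (s + 1) * PY (s + 1) * PV (s - 1) (s + 1)) - ι (PV s (s + 2)))) := by
    cases s with
    | zero => simp [Pn_zero]
    | succ s =>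
      rw [RR, if_neg (by omega), if_neg (by omega),
        show s + 1 + 2 - (s + 1 - 1) - 1 = 2 by omega,
        show s + 1 + 2 - 1 = s + 1 + 1 by omega, PV_swap (s + 1 + 1), PV_swap (s + 1 + 2),
        show s + 1 - 1 + 1 = s + 1 by omega, h2]
  rw [LocalId, show s + 1 + 1 = s + 2 by ring, e2, RR, if_neg (by omega), if_pos (by omega)]
  rw [show s + 1 + s - 1 = s + s by omega, PV_swap (s + 2) s, PV_swap (s + 1) s,
    PV_swap (s + 1) (s - 1), PV_diag, Pw_succ]
  simp only [PX_eq, PY_eq, map_mul, map_add, map_sub, map_one, map_pow, pow_one, div_one,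
    map_ofNat] at key ⊢
  exact key

lemma local_all (hn : ∀ n, ι (Pn (n + 1)) ≠ 0) (s N : ℕ) (h : 1 ≤ s + N) : LocalId ι s N := by
  rcases Nat.lt_trichotomy s N with h1 | h1 | h1
  · obtain ⟨d, rfl⟩ : ∃ d, N = s + d + 1 := ⟨N - s - 1, by omega⟩
    cases d with
    | zero => exact local_case_one ι hn s
    | succ e => exact local_case_pos ι hn s e
  · subst h1
    obtain ⟨r, rfl⟩ : ∃ r, s = r + 1 := ⟨s - 1, by omega⟩
    exact local_case_zero ι r
  · obtain ⟨d, rfl⟩ : ∃ d, s = N + d + 1 := ⟨s - N - 1, by omega⟩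
    cases d with
    | zero => exact local_case_neg_one ι hn N
    | succ e => exact local_case_neg ι hn N e

end Sums2


section QBin

lemma qb_zero (n : ℕ) : qbinom n 0 = 1 := by
  cases n <;> rw [qbinom]

lemma qb_succ (n k : ℕ) :
    qbinom (n + 1) (k + 1) = qbinom n k + qv ^ (k + 1) * qbinom n (k + 1) := by
  rw [qbinom]

lemma qb_gt (n k : ℕ) (h : n < k) : qbinom n k = 0 := by
  induction n generalizing k with
  | zero =>
    obtain ⟨j, rfl⟩ : ∃ j, k = j + 1 := ⟨k - 1, by omega⟩
    rw [qbinom]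
  | succ n ih =>
    obtain ⟨j, rfl⟩ : ∃ j, k = j + 1 := ⟨k - 1, by omega⟩
    rw [qb_succ, ih _ (by omega), ih _ (by omega)]; ring

lemma qb_self (n : ℕ) : qbinom n n = 1 := by
  induction n with
  | zero => exact qb_zero 0
  | succ n ih => rw [qb_succ, ih, qb_gt n (n + 1) (by omega)]; ring

lemma qb_abs (M k : ℕ) : qnum (k + 1) * qbinom (M + 1) (k + 1) = qnum (M + 1) * qbinom M k := by
  induction M generalizing k with
  | zero =>
    cases k with
    | zero => simp [qb_self, qb_zero]
    | succ k => simp [qb_gt 0 (k + 1) (by omega), qb_gt 1 (k + 1 + 1) (by omega)]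
  | succ M ih =>
    cases k with
    | zero =>
      have := ih 0
      rw [qb_succ, qb_zero, qnum_succ (M + 1)]
      simp only [zero_add, qnum_one, pow_one, qb_zero] at this ⊢
      linear_combination qv * this
    | succ j =>
      have h1 := ih (j + 1)
      have h2 := ih j
      rw [qb_succ (M + 1) (j + 1), qnum_succ (M + 1)]
      have h3 := qb_succ M j
      have h4 := qnum_succ (j + 1)
      rw [mul_add, ← mul_assoc, mul_comm _ (qv ^ _), mul_assoc, h1, h4]
      linear_combination qv * h2 - qv * qnum (M + 1) * h3

lemma qb_pascal (M s : ℕ) (h : s ≤ M) :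
    qbinom (M + 1) (s + 1) = qbinom M (s + 1) + qv ^ (M - s) * qbinom M s := by
  induction M generalizing s with
  | zero =>
    obtain rfl : s = 0 := by omega
    simp [qb_self, qb_gt 0 1 (by omega), qb_zero]
  | succ M ih =>
    rcases Nat.eq_or_lt_of_le h with rfl | h
    · rw [qb_self, qb_gt _ _ (Nat.lt_succ_self _), qb_self]; simp
    cases s with
    | zero =>
      have e1 := qb_abs M 0
      have e2 := qb_abs (M + 1) 0
      simp only [zero_add, qnum_one, one_mul, qb_zero, mul_one] at e1 e2 ⊢
      rw [e1, e2, Nat.sub_zero, qnum_succ (M + 1)]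
      have := qpow (M + 1)
      rw [this]; ring
    | succ j =>
      have h1 := ih j (by omega)
      have h2 := ih (j + 1) (by omega)
      rw [qb_succ (M + 1) (j + 1)]
      have h4 := qb_succ M (j + 1)
      have h5 := qb_succ M j
      rw [show M + 1 - (j + 1) = M - j by omega]
      obtain ⟨e, he⟩ : ∃ e, M - j = e + 1 := ⟨M - j - 1, by omega⟩
      rw [show M - (j + 1) = e by omega] at h2
      rw [he] at h1 ⊢
      linear_combination h1 - h4 - qv ^ (e + 1) * h5 + qv ^ (j + 2) * h2

lemma qb_ratio (M s : ℕ) (h : s ≤ M) :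
    qnum (s + 1) * qbinom M (s + 1) = qnum (M - s) * qbinom M s := by
  have h1 := qb_abs M s
  have h2 := qb_pascal M s h
  have h3 := qnum_add (M - s) (s + 1)
  rw [← qpow, show M - s + (s + 1) = M + 1 by omega] at h3
  linear_combination h1 - qnum (s + 1) * h2 + h3 * qbinom M s

lemma qb_up (M s : ℕ) (h : s ≤ M + 1) :
    qnum (M + 1) * qbinom M s = qnum (M + 1 - s) * qbinom (M + 1) s := by
  rw [← qb_abs, qb_ratio _ _ h]

lemma qb_symm (a c : ℕ) : qbinom (a + c) a = qbinom (a + c) c := by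
  induction h : a + c generalizing a c with
  | zero => obtain rfl : a = 0 := by omega
            obtain rfl : c = 0 := by omega
            rfl
  | succ M ih =>
    cases a with
    | zero => obtain rfl : c = M + 1 := by omega
              rw [qb_zero, qb_self]
    | succ a =>
      cases c with
      | zero => obtain rfl : a = M := by omega
                rw [qb_zero, qb_self]
      | succ c =>
        rw [qb_succ, qb_pascal M c (by omega), ih a (c + 1) (by omega), ih (a + 1) c (by omega),
          show M - c = a + 1 by omega]

end QBin

section Main

lemma bcoef_eq (n : ℕ) : bcoef n = Xv n + Yv n := by
  rw [bcoef, Xv, Yv]; ring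

lemma lcoef_eq (m : ℕ) : Polynomial.C (lcoef (m + 1)) = Pn (m + 1) * Pk m := by
  rw [lcoef, Pk]
  simp only [Pe1, Pe2, Pn, Pal, Pbe, Pq, ← Polynomial.C_mul, ← Polynomial.C_add,
    ← Polynomial.C_sub, ← Polynomial.C_1]
  congr 1
  rw [show 2 * (m + 1) - 1 = m + (m + 1) by omega, Nat.add_sub_cancel, pow_add, qpow m,
    qpow (m + 1)]
  ring

variable {F : Type*} [Field F] (ι : Polynomial R →+* F)

def PB' (M s : ℕ) : Polynomial R := Polynomial.C (qbinom M s)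

def PS (M : ℕ) : Polynomial R := ∑ s ∈ Finset.range (M + 1), PB' M s * PV s (M - s)

lemma PS_up (M : ℕ) : PS (M + 1) = ∑ s ∈ Finset.range (M + 1),
    PB' M s * (PV s (M - s + 1) + Pq ^ (M - s) * PV (s + 1) (M - s)) := by
  have e0 : ∑ s ∈ Finset.range (M + 1), PB' M s * PV s (M - s + 1)
      = ∑ s ∈ Finset.range (M + 1), PB' M (s + 1) * PV (s + 1) (M - s) + PV 0 (M + 1) := by
    have := Finset.sum_range_succ (fun s => PB' M s * PV s (M + 1 - s)) (M + 1)
    rw [Finset.sum_range_succ'] at this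
    have hz : PB' M (M + 1) = 0 := by rw [PB', qb_gt _ _ (Nat.lt_succ_self _)]; simp
    have h1 : PB' M 0 = 1 := by rw [PB', qb_zero]; simp
    rw [hz, h1, zero_mul, add_zero, one_mul, Nat.sub_zero] at this
    simp only [Nat.add_sub_add_right] at this
    rw [this]
    refine Finset.sum_congr rfl fun s hs => ?_
    rw [Finset.mem_range] at hs
    rw [show M - s + 1 = M + 1 - s by omega]
  simp only [mul_add, Finset.sum_add_distrib, e0]
  rw [PS, Finset.sum_range_succ']
  have h1 : PB' (M + 1) 0 = 1 := by rw [PB', qb_zero]; simp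
  rw [h1, one_mul, Nat.sub_zero, add_right_comm, ← Finset.sum_add_distrib]
  refine congrArg (fun y => y + PV 0 (M + 1)) ?_
  refine Finset.sum_congr rfl fun s hs => ?_
  rw [Finset.mem_range] at hs
  rw [Nat.add_sub_add_right, PB', qb_pascal M s (by omega)]
  simp only [PB', Pq, map_add, map_mul, map_pow]
  ring

lemma PS_down (m : ℕ) : Polynomial.C (lcoef (m + 1)) * PS m = ∑ s ∈ Finset.range (m + 1 + 1),
    PB' (m + 1) s * (Pk m * Pn (m + 1 - s) * PV s (m + 1 - s - 1)) := by
  rw [Finset.sum_range_succ, Nat.sub_self, Pn_zero]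
  simp only [mul_zero, zero_mul, add_zero]
  rw [PS, lcoef_eq, Finset.mul_sum]
  refine Finset.sum_congr rfl fun s hs => ?_
  rw [Finset.mem_range] at hs
  have := congrArg (Polynomial.C) (qb_up m s (by omega))
  rw [show m + 1 - s - 1 = m - s by omega]
  simp only [map_mul] at this
  simp only [PB', Pn]
  linear_combination Pk m * PV s (m - s) * this

lemma PS_rec_field (hn : ∀ n, ι (Pn (n + 1)) ≠ 0) (m : ℕ) :
    ι (PS (m + 2)) = ι ((Polynomial.X + Polynomial.C (bcoef (m + 1))) * PS (m + 1)
      - Polynomial.C (lcoef (m + 1)) * PS m) := by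
  have tele : ∀ s ∈ Finset.range (m + 1 + 1), ι (PB' (m + 1) s) *
      (ι (PV s (m + 1 - s + 1)) + ι (Pq ^ (m + 1 - s)) * ι (PV (s + 1) (m + 1 - s))
      - (ι Polynomial.X + (ι (PX (m + 1)) + ι (PY (m + 1)))) * ι (PV s (m + 1 - s))
      + ι (Pk m) * ι (Pn (m + 1 - s)) * ι (PV s (m + 1 - s - 1)))
      = ι (PB' (m + 1) s * Pn s) * RR ι s (m + 1 - s)
        - ι (PB' (m + 1) (s + 1) * Pn (s + 1)) * RR ι (s + 1) (m + 1 - (s + 1)) := by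
    intro s hs
    rw [Finset.mem_range] at hs
    have h := local_all ι hn s (m + 1 - s) (by omega)
    rw [LocalId, show s + (m + 1 - s) = m + 1 by omega, Nat.add_sub_cancel] at h
    rw [h]
    have h2 := congrArg (fun y => ι (Polynomial.C y)) (qb_ratio (m + 1) s (by omega))
    simp only [map_mul] at h2
    rw [show m + 1 - s - 1 = m + 1 - (s + 1) by omega]
    simp only [PB', Pn, map_mul]
    linear_combination RR ι (s + 1) (m + 1 - (s + 1)) * h2
  have hsum := Finset.sum_congr rfl tele
  rw [Finset.sum_range_sub' (fun s => ι (PB' (m + 1) s * Pn s) * RR ι s (m + 1 - s))] at hsum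
  have hz : PB' (m + 1) (m + 1 + 1) = 0 := by rw [PB', qb_gt _ _ (Nat.lt_succ_self _)]; simp
  rw [hz, Pn_zero] at hsum
  simp only [mul_zero, zero_mul, map_zero, sub_zero] at hsum
  rw [PS_down, show m + 2 = m + 1 + 1 by ring, PS_up, bcoef_eq]
  rw [← sub_eq_zero, ← hsum, PS]
  simp only [map_sub, map_mul, map_add, map_sum, Finset.mul_sum, PX, PY]
  rw [← Finset.sum_sub_distrib, ← Finset.sum_sub_distrib]
  refine Finset.sum_congr rfl fun s _ => ?_
  ring

lemma qnum_ne (n : ℕ) : qnum (n + 1) ≠ 0 := by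
  intro h
  have := congrArg (MvPolynomial.eval (fun _ => (1 : ℤ))) h
  simp [qnum, qv] at this
  omega

lemma PS_rec (m : ℕ) : PS (m + 2) = (Polynomial.X + Polynomial.C (bcoef (m + 1))) * PS (m + 1)
      - Polynomial.C (lcoef (m + 1)) * PS m := by
  have hinj := IsFractionRing.injective (Polynomial R) (FractionRing (Polynomial R))
  apply hinj
  refine PS_rec_field (algebraMap (Polynomial R) (FractionRing (Polynomial R))) ?_ m
  intro n h
  rw [map_eq_zero_iff _ hinj, Pn, Polynomial.C_eq_zero] at h
  exact qnum_ne n h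

lemma PS_phat (m : ℕ) : PS m = 2 * phat m := by
  have h0 : PS 0 = 2 * phat 0 := by
    simp [PS, phat, PB', qb_zero, PV_diag, Pw]
  have h1 : PS 1 = 2 * phat 1 := by
    rw [PS_up 0]
    simp only [zero_add, Finset.sum_range_one, PB', qb_zero, Nat.sub_self, pow_zero,
      PV_swap 1 0, PV_le 0 1 1 rfl, PD_one, phat, bcoef_eq, PX, PY, Pw, Finset.prod_range_zero,
      map_one, map_add]
    ring
  have : ∀ m, PS m = 2 * phat m ∧ PS (m + 1) = 2 * phat (m + 1) := by
    intro m
    induction m with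
    | zero => exact ⟨h0, h1⟩
    | succ m ih =>
      refine ⟨ih.2, ?_⟩
      rw [PS_rec, ih.1, ih.2, phat]; ring
  exact (this m).1

end Main


section Coef

/-- halved diagonal version -/
def PH (s : ℕ) : ℕ → Polynomial R
  | 0 => 1
  | d + 1 => PA s (d + 1) + PY (s + d) * PB s d

def Ph (M s : ℕ) : Polynomial R :=
  if 2 * s ≤ M then PB' M s * (Pw s * PH s (M - 2 * s)) else 0

lemma PV_split (M s : ℕ) (h : s ≤ M) : PB' M s * PV s (M - s) = Ph M s + Ph M (M - s) := by
  rcases Nat.lt_trichotomy (2 * s) M with h1 | h1 | h1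
  · rw [Ph, Ph, if_pos (by omega), if_neg (by omega), PV_le s (M - 2 * s) (M - s) (by omega)]
    obtain ⟨d, hd⟩ : ∃ d, M - 2 * s = d + 1 := ⟨M - 2 * s - 1, by omega⟩
    rw [hd, PD, PH, add_zero]
  · rw [show M - s = s by omega, PV_diag, Ph, if_pos (by omega), show M - 2 * s = 0 by omega, PH]
    ring
  · rw [Ph, Ph, if_neg (by omega), if_pos (by omega),
      PV_ge (M - s) (M - 2 * (M - s)) s (by omega)]
    obtain ⟨d, hd⟩ : ∃ d, M - 2 * (M - s) = d + 1 := ⟨M - 2 * (M - s) - 1, by omega⟩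
    have : PB' M s = PB' M (M - s) := by
      have := qb_symm s (M - s)
      rw [show s + (M - s) = M by omega] at this
      rw [PB', PB', this]
    rw [hd, PD, PH, zero_add, this]

lemma phat_eq (M : ℕ) : phat M = ∑ s ∈ Finset.range (M + 1), Ph M s := by
  have h1 := PS_phat M
  have h2 : PS M = 2 * ∑ s ∈ Finset.range (M + 1), Ph M s := by
    rw [PS, Finset.sum_congr rfl (g := fun s => Ph M s + Ph M (M - s)), Finset.sum_add_distrib,
      two_mul]
    · refine congrArg (fun y => _ + y) ?_
      rw [← Finset.sum_range_reflect]
      refine Finset.sum_congr rfl fun s hs => ?_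
      rw [Finset.mem_range] at hs
      congr 1
      omega
    · intro s hs
      rw [Finset.mem_range] at hs
      exact PV_split M s (by omega)
  rw [h2] at h1
  exact (mul_left_cancel₀ two_ne_zero h1).symm

def Cf (n k s : ℕ) : R :=
  TT (2 * s) (2 * n + 1) (k - 2 * s) +
    if k = 2 * s then 0 else Yv (n + k - s - 1) * TT (2 * s + 1) (2 * n + 1) (k - 2 * s - 1)

lemma PH_coeff (n k s : ℕ) (h : 2 * s ≤ k) : (PH s (n + k - 2 * s)).coeff n = Cf n k s := by
  obtain ⟨j, rfl⟩ := Nat.exists_eq_add_of_le h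
  rw [Cf, show n + (2 * s + j) - 2 * s = n + j by omega, Nat.add_sub_cancel_left]
  rcases Nat.eq_zero_or_pos (n + j) with h0 | h0
  · obtain rfl : n = 0 := by omega
    obtain rfl : j = 0 := by omega
    simp [PH, TT_zero]
  obtain ⟨d, hd⟩ : ∃ d, n + j = d + 1 := ⟨n + j - 1, by omega⟩
  rw [hd, PH, Polynomial.coeff_add, PY, Polynomial.coeff_C_mul, PA, PB, Gp_coeff, Gp_coeff,
    if_pos (by omega), show d + 1 - n = j by omega]
  rcases Nat.eq_zero_or_pos j with h1 | h1
  · rw [if_neg (by omega), if_pos (by omega), mul_zero]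
  · rw [if_pos (by omega), if_neg (by omega), show n + (2 * s + j) - s - 1 = s + d by omega,
      show d - n = j - 1 by omega]

lemma PH_coeff_zero (n d s : ℕ) (h : d < n) : (PH s d).coeff n = 0 := by
  cases d with
  | zero => 
    rw [PH, Polynomial.coeff_one, if_neg (by omega)]
  | succ d =>
    rw [PH, Polynomial.coeff_add, PY, Polynomial.coeff_C_mul, PA, PB, Gp_coeff, Gp_coeff,
      if_neg (by omega), if_neg (by omega)]
    ring

def ww (s : ℕ) : R := ∏ i ∈ Finset.range s, Xv i * Yv i

lemma Pw_eq (s : ℕ) : Pw s = Polynomial.C (ww s) := by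
  simp [Pw, ww, PX, PY, Finset.prod_mul_distrib]

lemma g_eq (n k : ℕ) : g (n + k) n = ∑ s ∈ Finset.range (k + 1),
    if 2 * s ≤ k then qbinom (n + k) s * (ww s * Cf n k s) else 0 := by
  rw [g, phat_eq, Polynomial.finsetSum_coeff]
  have hterm : ∀ s ∈ Finset.range (n + k + 1), (Ph (n + k) s).coeff n =
      if 2 * s ≤ k then qbinom (n + k) s * (ww s * Cf n k s) else 0 := by
    intro s _
    rw [Ph]
    by_cases h1 : 2 * s ≤ k
    · rw [if_pos (by omega), if_pos h1, PB', Pw_eq, Polynomial.coeff_C_mul,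
        Polynomial.coeff_C_mul, PH_coeff n k s h1]
    · rw [if_neg h1]
      by_cases h2 : 2 * s ≤ n + k
      · rw [if_pos h2, PB', Pw_eq, Polynomial.coeff_C_mul,
          Polynomial.coeff_C_mul, PH_coeff_zero _ _ _ (by omega)]
        ring
      · rw [if_neg h2, Polynomial.coeff_zero]
  rw [Finset.sum_congr rfl hterm]
  symm
  apply Finset.sum_subset
  · intro s hs
    rw [Finset.mem_range] at *
    omega
  · intro s _ hs
    rw [Finset.mem_range] at hs
    rw [if_neg (by omega)]

end Coef

section Reorg

/-- regroup a triangular sum according to the minimum -/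
lemma sum_min (k : ℕ) (F : ℕ → ℕ → R) :
    ∑ b ∈ Finset.range (k + 1), ∑ a ∈ Finset.range (k - b + 1), F a b =
    ∑ s ∈ Finset.range (k + 1), if 2 * s ≤ k then
      ∑ t ∈ Finset.range (k - 2 * s + 1), F (s + t) s
        + ∑ t ∈ Finset.range (k - 2 * s), F s (s + t + 1) else 0 := by
  induction k using Nat.strong_induction_on generalizing F with
  | _ k ih =>
    match k with
    | 0 => simp
    | 1 =>
      simp [Finset.sum_range_succ]
    | k + 2 =>
      have h := ih k (by omega) (fun a b => F (a + 1) (b + 1))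
      rw [Finset.sum_range_succ' _ (k + 2), Finset.sum_range_succ' _ (k + 2)]
      rw [Finset.sum_range_succ _ (k + 1), Finset.sum_range_succ _ (k + 1)]
      rw [if_neg (by omega), if_pos (by omega), add_zero]
      have e1 : ∀ b ∈ Finset.range (k + 1), ∑ a ∈ Finset.range (k + 2 - (b + 1) + 1), F a (b + 1)
          = ∑ a ∈ Finset.range (k - b + 1), F (a + 1) (b + 1) + F 0 (b + 1) := by
        intro b hb
        rw [Finset.mem_range] at hb
        rw [show k + 2 - (b + 1) + 1 = (k - b + 1) + 1 by omega, Finset.sum_range_succ']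
      rw [Finset.sum_congr rfl e1, Finset.sum_add_distrib, h]
      have e2 : ∀ s ∈ Finset.range (k + 1), (if 2 * (s + 1) ≤ k + 2 then
          ∑ t ∈ Finset.range (k + 2 - 2 * (s + 1) + 1), F (s + 1 + t) (s + 1)
        + ∑ t ∈ Finset.range (k + 2 - 2 * (s + 1)), F (s + 1) (s + 1 + t + 1) else 0) =
        (if 2 * s ≤ k then ∑ t ∈ Finset.range (k - 2 * s + 1), F (s + t + 1) (s + 1)
        + ∑ t ∈ Finset.range (k - 2 * s), F (s + 1) (s + t + 1 + 1) else 0) := by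
        intro s _
        rw [show k + 2 - 2 * (s + 1) = k - 2 * s by omega]
        simp only [show 2 * (s + 1) ≤ k + 2 ↔ 2 * s ≤ k by omega,
          show ∀ t, s + 1 + t = s + t + 1 from fun t => by ring]
      rw [Finset.sum_congr rfl e2]
      simp only [mul_zero, Nat.sub_zero, zero_add, Nat.sub_self,
        show k + 2 - (k + 1 + 1) + 1 = 1 by omega, Finset.sum_range_one]
      rw [Finset.sum_range_succ (fun t => F 0 (t + 1)) (k + 1)]
      ring

/-- iterate the left recurrence -/
lemma TT_left_iter (u w j : ℕ) : TT u (w + 1) j = ∑ t ∈ Finset.range (j + 1),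
    (∏ i ∈ Finset.range t, Z (u + 2 * i)) * TT (u + 2 * t + 1) w (j - t) := by
  induction j generalizing u with
  | zero => simp [TT_zero]
  | succ j ih =>
    rw [TT_left, ih (u + 2), Finset.sum_range_succ' _ (j + 1), Finset.mul_sum]
    simp only [Finset.prod_range_zero, mul_zero, add_zero, one_mul, Nat.sub_zero]
    rw [add_comm]
    refine congrArg (fun y => y + _) ?_
    refine Finset.sum_congr rfl fun t _ => ?_
    rw [Finset.prod_range_succ', Nat.add_sub_add_right]
    simp only [show ∀ i, u + 2 + 2 * i = u + 2 * (i + 1) from fun i => by ring, mul_zero, add_zero]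
    ring

/-- iterate the right recurrence -/
lemma TT_right_iter (u w j : ℕ) : TT u (w + 1) j = ∑ t ∈ Finset.range (j + 1),
    (∏ i ∈ Finset.range t, Z (u + w + 2 * (j - 1 - i))) * TT u w (j - t) := by
  induction j with
  | zero => simp [TT_zero]
  | succ j ih =>
    rw [TT_succ, ih, Finset.sum_range_succ' _ (j + 1), Finset.mul_sum]
    simp only [Finset.prod_range_zero, one_mul, Nat.sub_zero]
    rw [add_comm]
    refine congrArg (fun y => y + _) ?_
    refine Finset.sum_congr rfl fun t _ => ?_
    rw [Finset.prod_range_succ', Nat.add_sub_add_right j 1 t]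
    simp only [show ∀ i, j + 1 - 1 - (i + 1) = j - 1 - i from fun i => by omega,
      show j + 1 - 1 - 0 = j by omega]
    ring

end Reorg


section Lists

/-- sum of `Φ` over weakly decreasing lists of length `k` with entries `< c`. -/
def WW : ℕ → ℕ → (List ℕ → R) → R
  | _, 0, Φ => Φ []
  | 0, _ + 1, _ => 0
  | c + 1, k + 1, Φ => WW c (k + 1) Φ + WW (c + 1) k (fun l => Φ (c :: l))
termination_by c k => (c, k)

lemma WW_nil (c : ℕ) (Φ : List ℕ → R) : WW c 0 Φ = Φ [] := by
  cases c <;> rw [WW]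

lemma WW_zero (k : ℕ) (Φ : List ℕ → R) : WW 0 (k + 1) Φ = 0 := by
  rw [WW]

lemma WW_succ (c k : ℕ) (Φ : List ℕ → R) :
    WW (c + 1) (k + 1) Φ = WW c (k + 1) Φ + WW (c + 1) k (fun l => Φ (c :: l)) := by
  rw [WW]

lemma WW_congr (c k : ℕ) (Φ Ψ : List ℕ → R)
    (h : ∀ l : List ℕ, l.length = k → (∀ x ∈ l, x < c) → Φ l = Ψ l) : WW c k Φ = WW c k Ψ := by
  induction c generalizing k Φ Ψ with
  | zero =>
    cases k with
    | zero => rw [WW_nil, WW_nil]; exact h [] rfl (by simp)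
    | succ k => rw [WW_zero, WW_zero]
  | succ c ihc =>
    induction k generalizing Φ Ψ with
    | zero => rw [WW_nil, WW_nil]; exact h [] rfl (by simp)
    | succ k ihk =>
      rw [WW_succ, WW_succ, ihc (k + 1) Φ Ψ, ihk _ (fun l => Ψ (c :: l))]
      · intro l hl hx
        refine h _ (by simp [hl]) ?_
        intro x hx'
        rcases List.mem_cons.1 hx' with rfl | h'
        · omega
        · exact hx x h'
      · intro l hl hx
        exact h l hl fun x hx' => Nat.lt_succ_of_lt (hx x hx')

lemma WW_mul (c k : ℕ) (r : R) (Φ : List ℕ → R) :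
    WW c k (fun l => r * Φ l) = r * WW c k Φ := by
  induction c generalizing k Φ with
  | zero =>
    cases k with
    | zero => rw [WW_nil, WW_nil]
    | succ k => rw [WW_zero, WW_zero, mul_zero]
  | succ c ihc =>
    induction k generalizing Φ with
    | zero => rw [WW_nil, WW_nil]
    | succ k ihk =>
      rw [WW_succ, WW_succ, ihc (k + 1) Φ, ihk (fun l => Φ (c :: l)), mul_add]

lemma WW_tops (c k : ℕ) (Φ : List ℕ → R) : WW (c + 1) k Φ = ∑ b ∈ Finset.range (k + 1),
    WW c (k - b) (fun l => Φ (List.replicate b c ++ l)) := by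
  induction k generalizing Φ with
  | zero => simp [WW_nil]
  | succ k ih =>
    rw [WW_succ, ih, Finset.sum_range_succ' _ (k + 1), add_comm]
    simp only [Nat.add_sub_add_right, List.replicate_succ, List.cons_append, List.replicate_zero,
      List.nil_append, Nat.sub_zero]

lemma WW_zeros (c k : ℕ) (Φ : List ℕ → R) : WW (c + 1) k Φ = ∑ a ∈ Finset.range (k + 1),
    WW c (k - a) (fun l => Φ (l.map (· + 1) ++ List.replicate a 0)) := by
  induction c generalizing k Φ with
  | zero =>
    rw [WW_tops]
    refine Finset.sum_congr rfl fun a ha => ?_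
    rw [Finset.mem_range] at ha
    rcases Nat.eq_zero_or_pos (k - a) with h | h
    · rw [h, WW_nil, WW_nil]; simp
    · obtain ⟨j, hj⟩ : ∃ j, k - a = j + 1 := ⟨k - a - 1, by omega⟩
      rw [hj, WW_zero, WW_zero]
  | succ c ihc =>
    induction k generalizing Φ with
    | zero => simp [WW_nil]
    | succ k ihk =>
      rw [WW_succ, ihc, ihk, Finset.sum_range_succ _ (k + 1), Finset.sum_range_succ _ (k + 1),
        Nat.sub_self, WW_nil, WW_nil, add_right_comm, ← Finset.sum_add_distrib]
      refine congrArg (fun y => y + _) ?_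
      refine Finset.sum_congr rfl fun a ha => ?_
      rw [Finset.mem_range] at ha
      rw [show k + 1 - a = (k - a) + 1 by omega, WW_succ c]
      simp only [List.map_cons, List.cons_append]

def pl (u : ℕ) : List ℕ → R
  | [] => 1
  | h :: t => Z (u + h + 2 * t.length) * pl u t

lemma WW_pl (u w j : ℕ) : WW w j (pl u) = TT u w j := by
  induction w generalizing j with
  | zero =>
    cases j with
    | zero => rw [WW_nil, TT_zero, pl]
    | succ j => rw [WW_zero, TT_zero_succ]
  | succ w ihw =>
    induction j with
    | zero => rw [WW_nil, TT_zero, pl]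
    | succ j ihj =>
      rw [WW_succ, TT_succ, ihw, ← ihj, ← WW_mul]
      congr 1
      refine WW_congr _ _ _ _ fun l hl _ => ?_
      rw [pl, hl]

lemma pl_append (u : ℕ) (l1 l2 : List ℕ) :
    pl u (l1 ++ l2) = pl (u + 2 * l2.length) l1 * pl u l2 := by
  induction l1 with
  | nil => simp [pl]
  | cons h t ih =>
    rw [List.cons_append, pl, pl, ih, List.length_append, mul_assoc]
    congr 2
    ring

lemma pl_map (u : ℕ) (l : List ℕ) : pl u (l.map (· + 1)) = pl (u + 1) l := by
  induction l with
  | nil => simp [pl]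
  | cons h t ih =>
    rw [List.map_cons, pl, pl, ih, List.length_map]
    congr 2
    ring

lemma pl_replicate (u t v : ℕ) :
    pl u (List.replicate t v) = ∏ i ∈ Finset.range t, Z (u + v + 2 * i) := by
  induction t with
  | zero => simp [pl]
  | succ t ih => rw [List.replicate_succ, pl, ih, List.length_replicate, Finset.prod_range_succ,
      mul_comm]

lemma pl_prod (L : List ℕ) :
    pl 0 L = ∏ i ∈ Finset.range L.length, Z (L.getD (L.length - 1 - i) 0 + 2 * i) := by
  induction L with
  | nil => simp [pl]
  | cons h t ih =>
    rw [pl, ih, List.length_cons, Finset.prod_range_succ, mul_comm]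
    congr 1
    · refine Finset.prod_congr rfl fun i hi => ?_
      rw [Finset.mem_range] at hi
      rw [show t.length + 1 - 1 - i = (t.length - 1 - i) + 1 by omega, List.getD_cons_succ]
    · rw [show t.length + 1 - 1 - t.length = 0 by omega, List.getD_cons_zero, zero_add]

lemma pl_drop (L : List ℕ) (s : ℕ) : pl 0 (L.drop s) =
    ∏ i ∈ Finset.range (L.length - s), Z (L.getD (L.length - 1 - i) 0 + 2 * i) := by
  rw [pl_prod, List.length_drop]
  refine Finset.prod_congr rfl fun i hi => ?_
  rw [Finset.mem_range] at hi
  rw [List.getD_eq_getElem?_getD, List.getElem?_drop, ← List.getD_eq_getElem?_getD,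
    show s + (L.length - s - 1 - i) = L.length - 1 - i by omega]

lemma cnt_list (L : List ℕ) (v : ℕ) : cnt L.length (fun j => L.getD j 0) v = L.count v := by
  rw [cnt, Finset.card_filter]
  induction L with
  | nil => simp
  | cons h t ih =>
    rw [List.length_cons, Finset.sum_range_succ', List.count_cons, ← ih]
    simp

def UL (n : ℕ) (L : List ℕ) : R := uweight n L.length (fun j => L.getD j 0)

lemma UL_eq (n : ℕ) (a b : ℕ) (l : List ℕ) (hl : ∀ x ∈ l, x < 2 * n) (k : ℕ)
    (hk : l.length + a + b = k) :
    UL n (List.replicate b (2 * n + 1) ++ (l.map (· + 1) ++ List.replicate a 0)) =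
      (qbinom (n + k) (min a b) * (∏ j ∈ Finset.range (min a b), Yv j)
        * (∏ i ∈ Finset.range a, Xv i)
        * ∏ i ∈ Finset.range (b - min a b), Yv (n + (k - b) + i)) * pl (2 * a + 1) l := by
  have hlen : (List.replicate b (2 * n + 1) ++ (l.map (· + 1) ++ List.replicate a 0)).length
      = k := by
    simp only [List.length_append, List.length_replicate, List.length_map]; omega
  have hs : spart n k (fun j => (List.replicate b (2 * n + 1) ++
      (l.map (· + 1) ++ List.replicate a 0)).getD j 0) = min a b := by
    rw [spart]
    conv_lhs => rw [← hlen]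
    rw [cnt_list, cnt_list]
    have c0 : List.count 0 (List.map (· + 1) l) = 0 := by
      rw [List.count_eq_zero]; simp
    have c1 : List.count (2 * n + 1) (List.map (· + 1) l) = 0 := by
      rw [List.count_eq_zero]; intro h
      rw [List.mem_map] at h
      obtain ⟨x, hx, hx'⟩ := h
      have := hl x hx
      omega
    simp only [List.count_append, c0, c1, List.count_replicate]
    cases b with
    | zero =>
      simp
    | succ b => simp [List.replicate_succ]
  rw [UL, hlen, uweight, hs]
  have hp := pl_drop (List.replicate b (2 * n + 1) ++ (l.map (· + 1) ++ List.replicate a 0))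
    (min a b)
  rw [hlen] at hp
  rw [← hp, List.drop_append_of_le_length (by simp), List.drop_replicate, pl_append, pl_append,
    pl_map, pl_replicate, pl_replicate]
  simp only [List.length_append, List.length_map, List.length_replicate, zero_add, add_zero]
  have e1 : ∀ i, Z (2 * (l.length + a) + (2 * n + 1) + 2 * i) = Yv (n + (k - b) + i) := by
    intro i
    rw [← Z_odd]; congr 1; omega
  simp only [e1, Z_even]
  ring

lemma WW_sum (n k : ℕ) : WW (2 * n + 2) k (UL n) =
    ∑ b ∈ Finset.range (k + 1), ∑ a ∈ Finset.range (k - b + 1),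
      (qbinom (n + k) (min a b) * (∏ j ∈ Finset.range (min a b), Yv j)
        * (∏ i ∈ Finset.range a, Xv i)
        * ∏ i ∈ Finset.range (b - min a b), Yv (n + (k - b) + i))
        * TT (2 * a + 1) (2 * n) (k - b - a) := by
  rw [WW_tops]
  refine Finset.sum_congr rfl fun b hb => ?_
  rw [WW_zeros]
  refine Finset.sum_congr rfl fun a ha => ?_
  rw [Finset.mem_range] at ha hb
  rw [← WW_pl, ← WW_mul]
  refine WW_congr _ _ _ _ fun l hl hx => ?_
  exact UL_eq n a b l hx k (by omega)

lemma WW_main (n k : ℕ) : WW (2 * n + 2) k (UL n) = g (n + k) n := by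
  rw [WW_sum, sum_min, g_eq]
  refine Finset.sum_congr rfl fun s _ => ?_
  by_cases h : 2 * s ≤ k
  swap
  · rw [if_neg h, if_neg h]
  rw [if_pos h, if_pos h, Cf, mul_add, mul_add]
  obtain ⟨j, rfl⟩ := Nat.exists_eq_add_of_le h
  rw [Nat.add_sub_cancel_left]
  congr 1
  · rw [TT_left_iter, Finset.mul_sum, Finset.mul_sum]
    refine Finset.sum_congr rfl fun t ht => ?_
    rw [Finset.mem_range] at ht
    rw [show min (s + t) s = s by omega, Nat.sub_self, Finset.prod_range_zero,
      Finset.prod_range_add, ww, Finset.prod_mul_distrib,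
      show 2 * s + j - s - (s + t) = j - t by omega, show 2 * (s + t) + 1 = 2 * s + 2 * t + 1 by ring]
    simp only [← mul_add, Z_even]
    ring
  · cases j with
    | zero => simp
    | succ j =>
      rw [if_neg (by omega)]
      have h1 := TT_succ (2 * s + 1) (2 * n) j
      rw [TT_right_iter (2 * s + 1) (2 * n) (j + 1), Finset.sum_range_succ'] at h1
      simp only [Finset.prod_range_zero, one_mul, Nat.sub_zero] at h1
      rw [add_comm, add_left_cancel_iff] at h1
      rw [show 2 * s + 1 + 2 * n + 2 * j = 2 * (n + (2 * s + (j + 1)) - s - 1) + 1 by omega,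
        Z_odd] at h1
      rw [Nat.add_sub_cancel, ← h1, Finset.mul_sum, Finset.mul_sum]
      refine Finset.sum_congr rfl fun t ht => ?_
      rw [Finset.mem_range] at ht
      rw [show min s (s + t + 1) = s by omega, show s + t + 1 - s = t + 1 by omega,
        ww, Finset.prod_mul_distrib,
        show 2 * s + (j + 1) - (s + t + 1) - s = j + 1 - (t + 1) by omega]
      have e : ∏ i ∈ Finset.range (t + 1), Yv (n + (2 * s + (j + 1) - (s + t + 1)) + i) =
          ∏ i ∈ Finset.range (t + 1), Z (2 * s + 1 + 2 * n + 2 * (j + 1 - 1 - i)) := by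
        rw [← Finset.prod_range_reflect]
        refine Finset.prod_congr rfl fun i hi => ?_
        rw [Finset.mem_range] at hi
        rw [← Z_odd]; congr 1; omega
      rw [e]
      ring

lemma sum_WW (c k : ℕ) (Φ : List ℕ → R) :
    ∑ μ ∈ (Finset.univ : Finset (Fin k → Fin c)).filter
          (fun μ => ∀ i j : Fin k, i ≤ j → μ j ≤ μ i),
        Φ (List.ofFn fun i => (μ i : ℕ)) = WW c k Φ := by
  induction c generalizing k Φ with
  | zero =>
    cases k with
    | zero => rw [WW_nil]; simp [Finset.filter_true_of_mem]
    | succ k => rw [WW_zero]; simp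
  | succ c ihc =>
    induction k generalizing Φ with
    | zero => rw [WW_nil]; simp [Finset.filter_true_of_mem]
    | succ k ihk =>
      rw [WW_succ, ← ihc, ← ihk]
      have hset : (Finset.univ : Finset (Fin (k + 1) → Fin (c + 1))).filter
          (fun μ => ∀ i j : Fin (k + 1), i ≤ j → μ j ≤ μ i) =
        ((Finset.univ : Finset (Fin (k + 1) → Fin c)).filter
          (fun μ => ∀ i j : Fin (k + 1), i ≤ j → μ j ≤ μ i)).image
            (fun μ i => (μ i).castSucc) ∪
        ((Finset.univ : Finset (Fin k → Fin (c + 1))).filter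
          (fun μ => ∀ i j : Fin k, i ≤ j → μ j ≤ μ i)).image
            (fun μ => (Fin.cons (Fin.last c) μ : Fin (k + 1) → Fin (c + 1))) := by
        ext μ
        simp only [Finset.mem_filter, Finset.mem_univ, true_and, Finset.mem_union,
          Finset.mem_image]
        constructor
        · intro h
          by_cases h0 : μ 0 = Fin.last c
          · right
            refine ⟨fun i => μ i.succ, fun i j hij => h _ _ (Fin.succ_le_succ_iff.2 hij), ?_⟩
            ext i
            refine Fin.cases ?_ (fun i => ?_) i
            · simp [h0]
            · simp
          · left
            have hlt : ∀ i, (μ i : ℕ) < c := by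
              intro i
              have h1 := h 0 i (Fin.zero_le _)
              have h2 : (μ 0 : ℕ) ≠ c := fun hh => h0 (Fin.ext hh)
              have h3 := (μ 0).isLt
              have h4 : (μ i : ℕ) ≤ μ 0 := h1
              omega
            refine ⟨fun i => ⟨μ i, hlt i⟩, fun i j hij => h i j hij, ?_⟩
            ext i
            simp
        · rintro (⟨ν, h, rfl⟩ | ⟨ν, h, rfl⟩)
          · intro i j hij
            exact h i j hij
          · intro i j
            refine Fin.cases ?_ (fun i => ?_) i
            · intro _
              simp [Fin.le_last]
            · refine Fin.cases ?_ (fun j => ?_) j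
              · intro hij
                exact absurd hij (by simp [Fin.le_def])
              · intro hij
                simpa using h i j (Fin.succ_le_succ_iff.1 hij)
      rw [hset, Finset.sum_union, Finset.sum_image, Finset.sum_image]
      · congr 1
        refine Finset.sum_congr rfl fun μ _ => ?_
        simp [List.ofFn_succ]
      · intro μ _ ν _ h
        exact Fin.cons_right_injective _ h
      · intro μ _ ν _ h
        funext i
        exact Fin.castSucc_injective _ (congrFun h i)
      · rw [Finset.disjoint_left]
        intro μ h1 h2
        rw [Finset.mem_image] at h1 h2
        obtain ⟨a, _, rfl⟩ := h1
        obtain ⟨b, _, hb⟩ := h2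
        have := congrFun hb 0
        rw [Fin.cons_zero] at this
        exact absurd this.symm (Fin.castSucc_lt_last _).ne

lemma extFn_list {l c : ℕ} (μ : Fin l → Fin c) :
    extFn μ = fun j => (List.ofFn fun i => (μ i : ℕ)).getD j 0 := by
  funext j
  rw [extFn, List.getD_eq_getElem?_getD, List.getElem?_ofFn]
  split <;> simp

end Lists


/-- **Theorem `main1`.** The coefficient `g_{n+k,n}` of `x^n` in `p̂_{n+k}(x)`
is the weighted sum over all Young diagrams contained in a `k × (2n+1)` rectangle
(partitions with at most `k` parts, each part at most `2n+1`), with weight `u_n`. -/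
theorem first_formula_coefficients (n k : ℕ) :
    g (n + k) n =
      ∑ μ ∈ (Finset.univ : Finset (Fin k → Fin (2 * n + 2))).filter
          (fun μ => ∀ i j : Fin k, i ≤ j → μ j ≤ μ i),
        uweight n k (extFn μ) := by
  rw [← WW_main, ← sum_WW]
  refine Finset.sum_congr rfl fun μ _ => ?_
  rw [UL, List.length_ofFn, extFn_list]
end
end

section
/- For all n ≥ 1 and k ≥ 1: (i) the set of partitions contained in the (k+1)×(2n+1) rectangle is the disjoint union of B̂_{n+k,n}, the sets B^ν_{n+k,n} over all partitions ν ⊆ (k+1)×(2n−1) with s_{n−1}(ν) > 0, B^X_{n+k,n}, and B^Y_{n+k,n}; and (ii) the set of partitions contained in the (k−1)×(2n+1) rectangle is the disjoint union of the sets C^ν_{n+k,n} over all partitions ν ⊆ (k−1)×(2n+1) with ν_{k−1} ≥ 2, C^X_{n+k,n}, and C^Y_{n+k,n}. -/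
open Finset

/-- A partition contained in an `r × c` rectangle: a weakly decreasing function `ℕ → ℕ`
with all parts at most `c`, vanishing from index `r` on (padding with zeros). -/
def IsRect (r c : ℕ) (μ : ℕ → ℕ) : Prop :=
  (∀ i j, i ≤ j → μ j ≤ μ i) ∧ (∀ i, μ i ≤ c) ∧ ∀ i, r ≤ i → μ i = 0

/-- `B̂_{n+k,n}`: partitions `μ ⊆ (k+1)×(2n+1)` with `s_n(μ) = 0` and `s_{n−1}(μ) = 0`. -/
def Bhat (n k : ℕ) : Set (ℕ → ℕ) :=
  {μ | IsRect (k + 1) (2 * n + 1) μ ∧ spart n (k + 1) μ = 0 ∧ spart (n - 1) (k + 1) μ = 0}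

/-- The index set for the family `B^ν`: partitions `ν ⊆ (k+1)×(2n−1)` with `s_{n−1}(ν) > 0`. -/
def Bidx (n k : ℕ) : Set (ℕ → ℕ) :=
  {ν | IsRect (k + 1) (2 * n - 1) ν ∧ 0 < spart (n - 1) (k + 1) ν}

/-- `B^ν_{n+k,n} = {((2n+1)^i, (2n−1)^{l−i}, ν') : 0 ≤ i ≤ l}` where `l = s_{n−1}(ν)`
and `ν = ((2n−1)^l, ν')`. -/
def Bfam (n k : ℕ) (ν : ℕ → ℕ) : Set (ℕ → ℕ) :=
  {μ | ∃ i ≤ spart (n - 1) (k + 1) ν, μ = fun j => if j < i then 2 * n + 1 else ν j}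

/-- `B^X_{n+k,n}`: partitions `μ ⊆ (k+1)×(2n+1)` with `s_n(μ) = l > 0` and
`μ = ((2n+1)^l, 2n, μ')`. -/
def BX (n k : ℕ) : Set (ℕ → ℕ) :=
  {μ | IsRect (k + 1) (2 * n + 1) μ ∧ ∃ l, 0 < l ∧ spart n (k + 1) μ = l ∧
    (∀ j < l, μ j = 2 * n + 1) ∧ μ l = 2 * n}

/-- `B^Y_{n+k,n}`: partitions `μ ⊆ (k+1)×(2n+1)` with `s_n(μ) = l > 0` and
`μ = ((2n+1)^{l+1}, μ')`. -/
def BY (n k : ℕ) : Set (ℕ → ℕ) :=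
  {μ | IsRect (k + 1) (2 * n + 1) μ ∧ ∃ l, 0 < l ∧ spart n (k + 1) μ = l ∧
    ∀ j < l + 1, μ j = 2 * n + 1}

/-- `s̄_n(ν) = min(#{i : νᵢ = 2}, #{i : νᵢ = 2n+1})` for `ν` with `k−1` parts. -/
def sbar (n k : ℕ) (ν : ℕ → ℕ) : ℕ := min (cnt (k - 1) ν 2) (cnt (k - 1) ν (2 * n + 1))

/-- The index set for the family `C^ν`: partitions `ν ⊆ (k−1)×(2n+1)` with all parts `≥ 2`
(i.e. `ν_{k−1} ≥ 2`). -/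
def Cidx (n k : ℕ) : Set (ℕ → ℕ) :=
  {ν | IsRect (k - 1) (2 * n + 1) ν ∧ ∀ i < k - 1, 2 ≤ ν i}

/-- `C^ν_{n+k,n} = {(ν', 2^{l−i}, 0^i) : 0 ≤ i ≤ l}` where `l = s̄_n(ν)` and `ν = (ν', 2^l)`. -/
def Cfam (n k : ℕ) (ν : ℕ → ℕ) : Set (ℕ → ℕ) :=
  {μ | ∃ i ≤ sbar n k ν, μ = fun j => if j < (k - 1) - i then ν j else 0}

/-- `C^X_{n+k,n}`: partitions `ν ⊆ (k−1)×(2n+1)` with `s_n(ν) = l` and `ν = (ν', 0^{l+1})`. -/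
def CX (n k : ℕ) : Set (ℕ → ℕ) :=
  {ν | IsRect (k - 1) (2 * n + 1) ν ∧ ∃ l, spart n (k - 1) ν = l ∧ l + 1 ≤ k - 1 ∧
    ∀ j, (k - 1) - (l + 1) ≤ j → ν j = 0}

/-- `C^Y_{n+k,n}`: partitions `ν ⊆ (k−1)×(2n+1)` with `s_n(ν) = l` and `ν = (ν', 1, 0^l)`. -/
def CY (n k : ℕ) : Set (ℕ → ℕ) :=
  {ν | IsRect (k - 1) (2 * n + 1) ν ∧ ∃ l, spart n (k - 1) ν = l ∧ l + 1 ≤ k - 1 ∧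
    ν ((k - 1) - (l + 1)) = 1 ∧ ∀ j, (k - 1) - l ≤ j → ν j = 0}

theorem cnt_top_aux (l : ℕ) (μ : ℕ → ℕ) (v a : ℕ) (ha : a ≤ l)
    (h : ∀ j < l, (μ j = v ↔ j < a)) : cnt l μ v = a := by
  unfold cnt
  have : (Finset.range l).filter (fun i => μ i = v) = Finset.range a := by
    ext j
    simp only [Finset.mem_filter, Finset.mem_range]
    constructor
    · rintro ⟨h1, h2⟩
      exact (h j h1).1 h2
    · intro h1
      exact ⟨by omega, (h j (by omega)).2 h1⟩
  rw [this, Finset.card_range]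

theorem cnt_bot_aux (l : ℕ) (μ : ℕ → ℕ) (v z : ℕ) (hz : z ≤ l)
    (h : ∀ j < l, (μ j = v ↔ l - z ≤ j)) : cnt l μ v = z := by
  unfold cnt
  have : (Finset.range l).filter (fun i => μ i = v) = Finset.Ico (l - z) l := by
    ext j
    simp only [Finset.mem_filter, Finset.mem_range, Finset.mem_Ico]
    constructor
    · rintro ⟨h1, h2⟩
      exact ⟨(h j h1).1 h2, h1⟩
    · rintro ⟨h1, h2⟩
      exact ⟨h2, (h j h2).2 h1⟩
  rw [this, Nat.card_Ico]
  omega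

/-- A downward closed predicate below `l` is an initial segment. -/
theorem initial_seg (l : ℕ) (P : ℕ → Prop) (h : ∀ i j, i ≤ j → P j → P i) :
    ∃ a ≤ l, ∀ j < l, (P j ↔ j < a) := by
  induction l with
  | zero => exact ⟨0, le_rfl, fun j hj => by omega⟩
  | succ l ih =>
    obtain ⟨a, ha, H⟩ := ih
    by_cases hl : P l
    · refine ⟨l + 1, le_rfl, fun j hj => ⟨fun _ => hj, fun _ => h j l (by omega) hl⟩⟩
    · refine ⟨a, by omega, fun j hj => ?_⟩
      rcases Nat.lt_succ_iff_lt_or_eq.1 hj with h1 | h1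
      · exact H j h1
      · subst h1
        exact ⟨fun h => absurd h hl, fun h => by omega⟩

theorem cnt_top (l : ℕ) (μ : ℕ → ℕ) (c : ℕ) (h : ∀ i j, i ≤ j → μ j ≤ μ i)
    (hc : ∀ i, μ i ≤ c) : cnt l μ c ≤ l ∧ ∀ j < l, (μ j = c ↔ j < cnt l μ c) := by
  obtain ⟨a, ha, H⟩ := initial_seg l (fun j => μ j = c) (fun i j hij hj => by
    have := h i j hij
    have := hc i
    try simp only at hj
    omega)
  rw [cnt_top_aux l μ c a ha H]
  exact ⟨ha, H⟩

theorem cnt_bot (l : ℕ) (μ : ℕ → ℕ) (c : ℕ) (h : ∀ i j, i ≤ j → μ j ≤ μ i)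
    (hc : ∀ i < l, c ≤ μ i) : cnt l μ c ≤ l ∧ ∀ j < l, (μ j = c ↔ l - cnt l μ c ≤ j) := by
  obtain ⟨a, ha, H⟩ := initial_seg l (fun j => c < μ j) (fun i j hij hj => by
    have := h i j hij
    try simp only at hj ⊢
    omega)
  have H' : ∀ j < l, (μ j = c ↔ l - (l - a) ≤ j) := fun j hj => by
    have h1 := H j hj
    have h2 := hc j hj
    try simp only at h1
    omega
  rw [cnt_bot_aux l μ c (l - a) (by omega) H']
  exact ⟨by omega, H'⟩

theorem spart_spec (m r : ℕ) (μ : ℕ → ℕ) (h : IsRect r (2 * m + 1) μ) :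
    ∃ a z, a + z ≤ r ∧ (∀ j, μ j = 2 * m + 1 ↔ j < a) ∧ (∀ j, μ j = 0 ↔ r - z ≤ j) ∧
      spart m r μ = min z a := by
  obtain ⟨h1, h2, h3⟩ := h
  obtain ⟨ha, Ha⟩ := cnt_top r μ (2 * m + 1) h1 h2
  obtain ⟨hz, Hz⟩ := cnt_bot r μ 0 h1 (fun _ _ => Nat.zero_le _)
  have hs : spart m r μ = min (cnt r μ 0) (cnt r μ (2 * m + 1)) := by
    unfold spart
    split_ifs with h0
    · rfl
    · by_cases hr : 0 < r
      · have := Ha 0 hr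
        omega
      · omega
  generalize cnt r μ (2 * m + 1) = a at *
  generalize cnt r μ 0 = z at *
  refine ⟨a, z, ?_, ?_, ?_, hs⟩
  · by_contra hc
    have e1 := Ha (r - z) (by omega)
    have e2 := Hz (r - z) (by omega)
    omega
  · intro j
    by_cases hj : j < r
    · exact Ha j hj
    · have := h3 j (by omega)
      omega
  · intro j
    by_cases hj : j < r
    · exact Hz j hj
    · have := h3 j (by omega)
      omega

theorem spart_eq (m r : ℕ) (μ : ℕ → ℕ) (h : IsRect r (2 * m + 1) μ) (a z : ℕ) (hz : z ≤ r)
    (Ha : ∀ j, μ j = 2 * m + 1 ↔ j < a) (Hz : ∀ j, μ j = 0 ↔ r - z ≤ j) :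
    spart m r μ = min z a := by
  obtain ⟨a', z', h1, h2, h3, h4⟩ := spart_spec m r μ h
  have e1 := Ha a
  have e2 := h2 a
  have e3 := Ha a'
  have e4 := h2 a'
  have e5 := Hz (r - z)
  have e6 := h3 (r - z)
  have e7 := Hz (r - z')
  have e8 := h3 (r - z')
  rw [h4]
  omega

/-- Structure of members of `B^ν`, with `n = m + 1`. -/
theorem Bfam_spec (m k : ℕ) (ν μ : ℕ → ℕ) (hν : ν ∈ Bidx (m + 1) k)
    (hμ : μ ∈ Bfam (m + 1) k ν) :
    IsRect (k + 1) (2 * (m + 1) + 1) μ ∧ (∀ j, ν j = min (μ j) (2 * m + 1)) ∧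
    ((spart (m + 1) (k + 1) μ = 0 ∧ 0 < spart m (k + 1) μ) ∨
     (0 < spart (m + 1) (k + 1) μ ∧ μ (spart (m + 1) (k + 1) μ) ≤ 2 * m + 1)) := by
  obtain ⟨hr, hp⟩ := hν
  obtain ⟨i, hi, rfl⟩ := hμ
  rw [show m + 1 - 1 = m by omega] at *
  rw [show 2 * (m + 1) - 1 = 2 * m + 1 by omega] at hr
  obtain ⟨a, z, h1, h2, h3, h4⟩ := spart_spec m (k + 1) ν hr
  obtain ⟨r1, r2, r3⟩ := hr
  have hR : IsRect (k + 1) (2 * (m + 1) + 1)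
      (fun j => if j < i then 2 * (m + 1) + 1 else ν j) := by
    refine ⟨fun p q hpq => ?_, fun p => ?_, fun p hp => ?_⟩
    · have := r1 p q hpq
      have := r2 q
      try dsimp only
      split_ifs <;> omega
    · have := r2 p
      try dsimp only
      split_ifs <;> omega
    · have := r3 p hp
      try dsimp only
      split_ifs <;> omega
  refine ⟨hR, fun j => ?_, ?_⟩
  · have := r2 j
    have := h2 j
    try dsimp only
    split_ifs <;> omega
  · rcases Nat.eq_zero_or_pos i with h0 | h0
    · left
      subst h0
      simp only [Nat.not_lt_zero, if_false]
      refine ⟨?_, hp⟩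
      have h00 := r2 0
      have hne : ¬ (ν 0 = 2 * (m + 1) + 1) := by omega
      unfold spart
      exact if_neg hne
    · right
      have hs := spart_eq (m + 1) (k + 1) _ hR i z (by omega) (fun j => by
          have := r2 j
          try dsimp only
          split_ifs <;> omega) (fun j => by
          have := h3 j
          try dsimp only
          split_ifs <;> first | omega | (simp only [false_iff]; omega))
      rw [hs, show min z i = i by omega]
      refine ⟨h0, ?_⟩
      try dsimp only
      rw [if_neg (by omega)]
      exact r2 i

/-- Structure of members of `C^ν`, with `k = r + 1`. -/
theorem Cfam_spec (n r : ℕ) (hn : 1 ≤ n) (ν μ : ℕ → ℕ) (hν : ν ∈ Cidx n (r + 1))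
    (hμ : μ ∈ Cfam n (r + 1) ν) :
    IsRect r (2 * n + 1) μ ∧ (∀ j < r, ν j = if μ j = 0 then 2 else μ j) ∧
    (∀ j < r - spart n r μ, 2 ≤ μ j) := by
  obtain ⟨hr, hp⟩ := hν
  obtain ⟨i, hi, rfl⟩ := hμ
  simp only [Nat.add_sub_cancel] at *
  obtain ⟨a, z, h1, h2, h3, h4⟩ := spart_spec n r ν hr
  obtain ⟨r1, r2, r3⟩ := hr
  have hi' : i ≤ cnt r ν 2 ∧ i ≤ cnt r ν (2 * n + 1) := by
    unfold sbar at hi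
    simp only [Nat.add_sub_cancel] at hi
    omega
  rw [cnt_top_aux r ν (2 * n + 1) a (by omega) (fun j _ => h2 j)] at hi'
  obtain ⟨b1, b2⟩ := cnt_bot r ν 2 r1 hp
  generalize cnt r ν 2 = b at *
  have hab : a + b ≤ r := by
    by_contra hc
    have e1 := h2 (r - b)
    have e2 := b2 (r - b) (by omega)
    omega
  have hR : IsRect r (2 * n + 1) (fun j => if j < r - i then ν j else 0) := by
    refine ⟨fun p q hpq => ?_, fun p => ?_, fun p hp => ?_⟩
    · have := r1 p q hpq
      try dsimp only
      split_ifs <;> omega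
    · have := r2 p
      try dsimp only
      split_ifs <;> omega
    · dsimp only
      split_ifs <;> omega
  refine ⟨hR, fun j hj => ?_, ?_⟩
  · have := hp j hj
    have := b2 j hj
    try dsimp only
    split_ifs <;> omega
  · have hs := spart_eq n r _ hR a i (by omega) (fun j => by
          have := h2 j
          try dsimp only
          split_ifs <;> first | omega | (simp only [false_iff]; omega)) (fun j => by
          try dsimp only
          split_ifs with hj
          · have := hp j (by omega)
            omega
          · omega)
    rw [hs, show min i a = i by omega]
    intro j hj
    try dsimp only
    rw [if_pos hj]
    exact hp j (by omega)

theorem union_B (m k : ℕ) (μ : ℕ → ℕ) (h : IsRect (k + 1) (2 * (m + 1) + 1) μ)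
    (hb : μ ∉ Bhat (m + 1) k) (hx : μ ∉ BX (m + 1) k) (hy : μ ∉ BY (m + 1) k) :
    ∃ ν ∈ Bidx (m + 1) k, μ ∈ Bfam (m + 1) k ν := by
  obtain ⟨a, z, h1, h2, h3, h4⟩ := spart_spec (m + 1) (k + 1) μ h
  have hR := h
  obtain ⟨r1, r2, r3⟩ := h
  by_cases hs : spart (m + 1) (k + 1) μ = 0
  · have hs' : spart m (k + 1) μ ≠ 0 := fun h' => hb ⟨hR, hs, by simpa using h'⟩
    have h0 : μ 0 = 2 * m + 1 := by
      by_contra hc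
      exact hs' (by unfold spart; rw [if_neg hc])
    refine ⟨μ, ⟨⟨r1, fun i => ?_, r3⟩, ?_⟩, 0, Nat.zero_le _, ?_⟩
    · have := r1 0 i (Nat.zero_le _)
      omega
    · simpa using Nat.pos_of_ne_zero hs'
    · simp
  · have haz : a ≤ z := by
      by_contra hc
      exact hy ⟨hR, z, by omega, by omega, fun j hj => (h2 j).2 (by omega)⟩
    have hxa : μ a ≠ 2 * (m + 1) := fun hc =>
      hx ⟨hR, a, by omega, by omega, fun j hj => (h2 j).2 hj, hc⟩
    have hle : ∀ j, a ≤ j → μ j ≤ 2 * m + 1 := fun j hj => by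
      have e1 := r1 a j hj
      have e2 := h2 a
      have e3 := r2 a
      omega
    have hν : IsRect (k + 1) (2 * m + 1) (fun j => min (μ j) (2 * m + 1)) := by
      refine ⟨fun p q hpq => ?_, fun p => ?_, fun p hp => ?_⟩
      · have := r1 p q hpq
        try dsimp only
        omega
      · dsimp only
        omega
      · have := r3 p hp
        try dsimp only
        omega
    obtain ⟨a', z', g1, g2, g3, g4⟩ := spart_spec m (k + 1) _ hν
    try dsimp only at g2 g3
    have ha' : a ≤ a' := by
      by_contra hc
      have e1 := g2 a'
      have e2 := h2 a'
      omega
    have hz' : z ≤ z' := by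
      have e1 := g3 (k + 1 - z)
      have e2 := h3 (k + 1 - z)
      omega
    refine ⟨fun j => min (μ j) (2 * m + 1), ⟨?_, ?_⟩, a, ?_, ?_⟩
    · rw [show 2 * (m + 1) - 1 = 2 * m + 1 by omega]
      exact hν
    · rw [show m + 1 - 1 = m by omega, g4]
      omega
    · rw [show m + 1 - 1 = m by omega, g4]
      omega
    · funext j
      have e1 := h2 j
      have e2 := hle j
      show μ j = if j < a then 2 * (m + 1) + 1 else min (μ j) (2 * m + 1)
      split_ifs <;> omega

theorem union_C (n r : ℕ) (hn : 1 ≤ n) (μ : ℕ → ℕ) (h : IsRect r (2 * n + 1) μ)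
    (hx : μ ∉ CX n (r + 1)) (hy : μ ∉ CY n (r + 1)) :
    ∃ ν ∈ Cidx n (r + 1), μ ∈ Cfam n (r + 1) ν := by
  obtain ⟨a, z, h1, h2, h3, h4⟩ := spart_spec n r μ h
  have hR := h
  obtain ⟨r1, r2, r3⟩ := h
  have hza : z ≤ a := by
    by_contra hc
    refine hx ⟨hR, a, ?_, ?_, fun j hj => (h3 j).2 ?_⟩ <;>
      simp only [Nat.add_sub_cancel] at * <;> omega
  have hge : ∀ j < r - z, 2 ≤ μ j := by
    intro j hj
    by_contra hc
    refine hy ⟨hR, z, ?_, ?_, ?_, fun j hj => (h3 j).2 ?_⟩ <;>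
      simp only [Nat.add_sub_cancel] at *
    · omega
    · omega
    · have e1 := r1 j (r - (z + 1)) (by omega)
      have e2 := h3 (r - (z + 1))
      omega
    · omega
  have hν : IsRect r (2 * n + 1) (fun j => if j < r - z then μ j else if j < r then 2 else 0) := by
    refine ⟨fun p q hpq => ?_, fun p => ?_, fun p hp => ?_⟩
    · have := r1 p q hpq
      have := hge p
      try dsimp only
      split_ifs <;> omega
    · have := r2 p
      try dsimp only
      split_ifs <;> omega
    · dsimp only
      split_ifs <;> omega
  have hν2 : ∀ j < r, 2 ≤ (fun j => if j < r - z then μ j else if j < r then 2 else 0) j := by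
    intro j hj
    have := hge j
    try dsimp only
    split_ifs <;> omega
  refine ⟨_, ⟨hν, hν2⟩, z, ?_, ?_⟩
  · unfold sbar
    simp only [Nat.add_sub_cancel]
    have ct := cnt_top_aux r (fun j => if j < r - z then μ j else if j < r then 2 else 0)
      (2 * n + 1) a (by omega) (fun j hj => by
        have := h2 j
        try dsimp only
        split_ifs <;> omega)
    rw [ct]
    obtain ⟨b1, b2⟩ := cnt_bot r _ 2 hν.1 hν2
    generalize cnt r (fun j => if j < r - z then μ j else if j < r then 2 else 0) 2 = b at *
    have : z ≤ b := by
      by_contra hc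
      have e := b2 (r - z) (by omega)
      try dsimp only at e
      rw [if_neg (by omega), if_pos (by omega)] at e
      omega
    omega
  · funext j
    simp only [Nat.add_sub_cancel]
    have := h3 j
    split_ifs <;> omega

/-- **Proposition `decom`.** For `n, k ≥ 1`:
(i) the set of partitions contained in the `(k+1)×(2n+1)` rectangle is the disjoint union of
`B̂`, the family `B^ν` (over `ν ⊆ (k+1)×(2n−1)` with `s_{n−1}(ν) > 0`), `B^X` and `B^Y`;
(ii) the set of partitions contained in the `(k−1)×(2n+1)` rectangle is the disjoint union of
the family `C^ν` (over `ν ⊆ (k−1)×(2n+1)` with `ν_{k−1} ≥ 2`), `C^X` and `C^Y`. -/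
theorem rectangle_decomposition (n k : ℕ) (hn : 1 ≤ n) (hk : 1 ≤ k) :
    -- (i) union
    ({μ : ℕ → ℕ | IsRect (k + 1) (2 * n + 1) μ} =
        Bhat n k ∪ (⋃ ν ∈ Bidx n k, Bfam n k ν) ∪ BX n k ∪ BY n k) ∧
    -- (i) pairwise disjointness
    Disjoint (Bhat n k) (⋃ ν ∈ Bidx n k, Bfam n k ν) ∧
    Disjoint (Bhat n k) (BX n k) ∧
    Disjoint (Bhat n k) (BY n k) ∧
    (∀ ν ∈ Bidx n k, ∀ ν' ∈ Bidx n k, ν ≠ ν' → Disjoint (Bfam n k ν) (Bfam n k ν')) ∧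
    (∀ ν ∈ Bidx n k, Disjoint (Bfam n k ν) (BX n k)) ∧
    (∀ ν ∈ Bidx n k, Disjoint (Bfam n k ν) (BY n k)) ∧
    Disjoint (BX n k) (BY n k) ∧
    -- (ii) union
    ({μ : ℕ → ℕ | IsRect (k - 1) (2 * n + 1) μ} =
        (⋃ ν ∈ Cidx n k, Cfam n k ν) ∪ CX n k ∪ CY n k) ∧
    -- (ii) pairwise disjointness
    (∀ ν ∈ Cidx n k, ∀ ν' ∈ Cidx n k, ν ≠ ν' → Disjoint (Cfam n k ν) (Cfam n k ν')) ∧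
    (∀ ν ∈ Cidx n k, Disjoint (Cfam n k ν) (CX n k)) ∧
    (∀ ν ∈ Cidx n k, Disjoint (Cfam n k ν) (CY n k)) ∧
    Disjoint (CX n k) (CY n k) := by
  obtain ⟨m, rfl⟩ : ∃ m, n = m + 1 := ⟨n - 1, by omega⟩
  obtain ⟨r, rfl⟩ : ∃ r, k = r + 1 := ⟨k - 1, by omega⟩
  refine ⟨?_, ?_, ?_, ?_, ?_, ?_, ?_, ?_, ?_, ?_, ?_, ?_, ?_⟩
  · ext μ
    simp only [Set.mem_ofPred_eq, Set.mem_union, Set.mem_iUnion, exists_prop]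
    constructor
    · intro h
      by_contra hc
      push Not at hc
      obtain ⟨⟨⟨c1, c2⟩, c3⟩, c4⟩ := hc
      obtain ⟨ν, hν, hμ⟩ := union_B m (r + 1) μ h c1 c3 c4
      exact c2 ν hν hμ
    · rintro (((h | ⟨ν, hν, hμ⟩) | h) | h)
      · exact h.1
      · exact (Bfam_spec m (r + 1) ν μ hν hμ).1
      · exact h.1
      · exact h.1
  · rw [Set.disjoint_left]
    rintro μ ⟨_, h1, h2⟩ hμ
    simp only [Set.mem_iUnion, exists_prop] at hμ
    obtain ⟨ν, hν, hμ⟩ := hμ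
    obtain ⟨-, -, h⟩ := Bfam_spec m (r + 1) ν μ hν hμ
    rw [show m + 1 - 1 = m by omega] at h2
    omega
  · rw [Set.disjoint_left]
    rintro μ ⟨_, h1, h2⟩ ⟨_, l, h3, h4, _⟩
    omega
  · rw [Set.disjoint_left]
    rintro μ ⟨_, h1, h2⟩ ⟨_, l, h3, h4, _⟩
    omega
  · intro ν hν ν' hν' hne
    rw [Set.disjoint_left]
    intro μ hμ hμ'
    refine hne (funext fun j => ?_)
    rw [(Bfam_spec m (r + 1) ν μ hν hμ).2.1 j, (Bfam_spec m (r + 1) ν' μ hν' hμ').2.1 j]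
  · intro ν hν
    rw [Set.disjoint_left]
    rintro μ hμ ⟨_, l, h3, rfl, h5, h6⟩
    obtain ⟨-, -, h⟩ := Bfam_spec m (r + 1) ν μ hν hμ
    omega
  · intro ν hν
    rw [Set.disjoint_left]
    rintro μ hμ ⟨_, l, h3, rfl, h5⟩
    obtain ⟨-, -, h⟩ := Bfam_spec m (r + 1) ν μ hν hμ
    have := h5 _ (Nat.lt_succ_self _)
    omega
  · rw [Set.disjoint_left]
    rintro μ ⟨_, l, h3, rfl, h5, h6⟩ ⟨_, l', h3', rfl, h5'⟩
    have := h5' _ (Nat.lt_succ_self _)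
    omega
  · ext μ
    simp only [Set.mem_ofPred_eq, Set.mem_union, Set.mem_iUnion, exists_prop]
    constructor
    · intro h
      by_contra hc
      push Not at hc
      obtain ⟨⟨c2, c3⟩, c4⟩ := hc
      obtain ⟨ν, hν, hμ⟩ := union_C (m + 1) r hn μ h c3 c4
      exact c2 ν hν hμ
    · rintro ((⟨ν, hν, hμ⟩ | h) | h)
      · exact (Cfam_spec (m + 1) r hn ν μ hν hμ).1
      · exact h.1
      · exact h.1
  · intro ν hν ν' hν' hne
    rw [Set.disjoint_left]
    intro μ hμ hμ'
    refine hne (funext fun j => ?_)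
    by_cases hj : j < r
    · rw [(Cfam_spec (m + 1) r hn ν μ hν hμ).2.1 j hj,
        (Cfam_spec (m + 1) r hn ν' μ hν' hμ').2.1 j hj]
    · rw [hν.1.2.2 j (by omega), hν'.1.2.2 j (by omega)]
  · intro ν hν
    rw [Set.disjoint_left]
    rintro μ hμ ⟨_, l, rfl, h5, h6⟩
    obtain ⟨-, -, h⟩ := Cfam_spec (m + 1) r hn ν μ hν hμ
    simp only [Nat.add_sub_cancel] at h5 h6
    have e1 := h6 _ le_rfl
    have e2 := h (r - (spart (m + 1) r μ + 1)) (by omega)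
    omega
  · intro ν hν
    rw [Set.disjoint_left]
    rintro μ hμ ⟨_, l, rfl, h5, h6, h7⟩
    obtain ⟨-, -, h⟩ := Cfam_spec (m + 1) r hn ν μ hν hμ
    simp only [Nat.add_sub_cancel] at h5 h6
    have e2 := h (r - (spart (m + 1) r μ + 1)) (by omega)
    omega
  · rw [Set.disjoint_left]
    rintro μ ⟨_, l, rfl, h5, h6⟩ ⟨_, l', rfl, h5', h6', h7'⟩
    have e1 := h6 _ le_rfl
    omega
end
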